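/- The number of isomorphism classes of left braces $(B,+,\cdot)$ with additive group $(B,+)$ isomorphic to $C_2\times C_2\times C_4\times C_4$ and multiplicative group $(B,\cdot)$ isomorphic to $C_2\times C_2\times C_2\times C_8$ is $40$. -/

import Mathlib

/-- A left brace structure on a set `B`: an abelian group operation `+` (with
zero element `zero` and negation `neg`), a group operation `*` (with identity
`one` and inversion `inv`), linked by the relation
`x * (y + z) = x * y - x + x * z`, i.e. `x * (y + z) = (x * y + (-x)) + x * z`. -/
structure LeftBrace (B : Type*) where
  add : B → B → B
  zero : B
  neg : B → B
  mul : B → B → B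
  one : B
  inv : B → B
  add_assoc : ∀ a b c, add (add a b) c = add a (add b c)
  add_comm : ∀ a b, add a b = add b a
  zero_add : ∀ a, add zero a = a
  neg_add_cancel : ∀ a, add (neg a) a = zero
  mul_assoc : ∀ a b c, mul (mul a b) c = mul a (mul b c)
  one_mul : ∀ a, mul one a = a
  mul_one : ∀ a, mul a one = a
  inv_mul_cancel : ∀ a, mul (inv a) a = one
  brace : ∀ x y z, mul x (add y z) = add (add (mul x y) (neg x)) (mul x z)

/-- Two left braces are isomorphic if there is a bijection preserving both
operations. -/
def LeftBrace.Iso {B₁ B₂ : Type*} (L₁ : LeftBrace B₁) (L₂ : LeftBrace B₂) : Prop :=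
  ∃ e : B₁ ≃ B₂, (∀ x y, e (L₁.add x y) = L₂.add (e x) (e y)) ∧
    (∀ x y, e (L₁.mul x y) = L₂.mul (e x) (e y))

/-- The additive group of the left brace `L` is isomorphic to the
(additively written) abelian group `A`. -/
def LeftBrace.AddIso {B : Type*} (L : LeftBrace B) (A : Type*) [AddGroup A] : Prop :=
  ∃ e : B ≃ A, ∀ x y, e (L.add x y) = e x + e y

/-- The multiplicative group of the left brace `L` is isomorphic to the
(additively written) group `A`. -/
def LeftBrace.MulIso {B : Type*} (L : LeftBrace B) (A : Type*) [AddGroup A] : Prop :=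
  ∃ e : B ≃ A, ∀ x y, e (L.mul x y) = e x + e y


namespace BB
abbrev A := ZMod 2 × ZMod 2 × ZMod 4 × ZMod 4

def dec (n : ℕ) : A := ((n : ZMod 2), ((n / 2 : ℕ) : ZMod 2), ((n / 4 : ℕ) : ZMod 4), ((n / 16 : ℕ) : ZMod 4))
def ec (u : A) : ℕ := u.1.val + 2 * u.2.1.val + 4 * u.2.2.1.val + 16 * u.2.2.2.val

theorem dec_ec : ∀ u : A, dec (ec u) = u := by decide +kernel
theorem ec_lt : ∀ u : A, ec u < 64 := by decide +kernel
theorem ec_dec : ∀ n < 64, ec (dec n) = n := by decide +kernel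

def enc (p q r s : ℕ) : ℕ := p % 2 + 2 * (q % 2) + 4 * (r % 4) + 16 * (s % 4)

theorem dec_enc (p q r s : ℕ) : dec (enc p q r s) = ((p : ZMod 2), (q : ZMod 2), (r : ZMod 4), (s : ZMod 4)) := by
  unfold dec enc
  refine Prod.ext ?_ (Prod.ext ?_ (Prod.ext ?_ ?_)) <;> simp only <;>
    rw [ZMod.natCast_eq_natCast_iff'] <;> omega

def lin (m0 m1 m2 m3 v : ℕ) : ℕ :=
  enc ((v % 2) * (m0 % 2) + (v / 2 % 2) * (m1 % 2) + (v / 4 % 4) * (m2 % 2) + (v / 16 % 4) * (m3 % 2))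
   ((v % 2) * (m0 / 2 % 2) + (v / 2 % 2) * (m1 / 2 % 2) + (v / 4 % 4) * (m2 / 2 % 2) + (v / 16 % 4) * (m3 / 2 % 2))
   ((v % 2) * (m0 / 4 % 4) + (v / 2 % 2) * (m1 / 4 % 4) + (v / 4 % 4) * (m2 / 4 % 4) + (v / 16 % 4) * (m3 / 4 % 4))
   ((v % 2) * (m0 / 16 % 4) + (v / 2 % 2) * (m1 / 16 % 4) + (v / 4 % 4) * (m2 / 16 % 4) + (v / 16 % 4) * (m3 / 16 % 4))

theorem dec_lin (m0 m1 m2 m3 v : ℕ) : dec (lin m0 m1 m2 m3 v) =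
    (v % 2) • dec m0 + (v / 2 % 2) • dec m1 + (v / 4 % 4) • dec m2 + (v / 16 % 4) • dec m3 := by
  unfold lin
  rw [dec_enc]
  unfold dec
  refine Prod.ext ?_ (Prod.ext ?_ (Prod.ext ?_ ?_)) <;> 
    simp only [Prod.fst_add, Prod.snd_add, Prod.smul_fst, Prod.smul_snd] <;>
    simp only [nsmul_eq_mul, Nat.cast_add, Nat.cast_mul, ZMod.natCast_mod]

theorem dec_gen (v : ℕ) : dec v =
    (v % 2) • dec 1 + (v / 2 % 2) • dec 2 + (v / 4 % 4) • dec 4 + (v / 16 % 4) • dec 16 := by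
  rw [← dec_lin]
  unfold lin
  rw [dec_enc]
  simp [dec]

def addc (u v : ℕ) : ℕ := enc (u + v) (u / 2 + v / 2) (u / 4 + v / 4) (u / 16 + v / 16)
theorem dec_addc (u v : ℕ) : dec (addc u v) = dec u + dec v := by
  unfold addc
  rw [dec_enc]
  simp [dec]

theorem dec_zero : dec 0 = 0 := by decide
theorem dec_surj (u : A) : ∃ n < 64, dec n = u := ⟨ec u, ec_lt u, dec_ec u⟩
theorem dec_inj {m n : ℕ} (hm : m < 64) (hn : n < 64) (h : dec m = dec n) : m = n := by
  rw [← ec_dec m hm, h, ec_dec n hn]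

section lift
variable {G : Type*} [AddCommGroup G]

def zl (n : ℕ) (a : G) (h : n • a = 0) : ZMod n →+ G :=
  ZMod.lift n ⟨zmultiplesHom G a, by simpa using h⟩

theorem zl_cast (n : ℕ) (a : G) (h : n • a = 0) (k : ℕ) : zl n a h (k : ZMod n) = k • a := by
  have := ZMod.lift_coe n ⟨zmultiplesHom G a, by simpa using h⟩ (k : ℤ)
  simpa [zl] using this

def lift4 (a b c d : G) (ha : 2 • a = 0) (hb : 2 • b = 0) (hc : 4 • c = 0) (hd : 4 • d = 0) : A →+ G :=
  (zl 2 a ha).coprod ((zl 2 b hb).coprod ((zl 4 c hc).coprod (zl 4 d hd)))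

theorem nsmul_mod {a : G} {k : ℕ} (h : k • a = 0) (n : ℕ) : (n % k) • a = n • a := by
  conv_rhs => rw [← Nat.mod_add_div n k]
  rw [add_nsmul, mul_comm, mul_nsmul', h]; simp

theorem lift4_dec (a b c d : G) (ha hb hc hd) (v : ℕ) : lift4 a b c d ha hb hc hd (dec v) =
    (v % 2) • a + (v / 2 % 2) • b + (v / 4 % 4) • c + (v / 16 % 4) • d := by
  simp only [lift4, dec, AddMonoidHom.coprod_apply, zl_cast, nsmul_mod ha, nsmul_mod hb, nsmul_mod hc, nsmul_mod hd]
  abel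

theorem map_dec (f : A →+ G) (v : ℕ) : f (dec v) =
    (v % 2) • f (dec 1) + (v / 2 % 2) • f (dec 2) + (v / 4 % 4) • f (dec 4) + (v / 16 % 4) • f (dec 16) := by
  conv_lhs => rw [dec_gen v]
  simp only [map_add, map_nsmul]

theorem map_lin (f : A →+ G) (m0 m1 m2 m3 v : ℕ) : f (dec (lin m0 m1 m2 m3 v)) =
    (v % 2) • f (dec m0) + (v / 2 % 2) • f (dec m1) + (v / 4 % 4) • f (dec m2) + (v / 16 % 4) • f (dec m3) := by
  rw [dec_lin]
  simp only [map_add, map_nsmul]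

theorem hom_ext4 {f g : A →+ G} (h1 : f (dec 1) = g (dec 1)) (h2 : f (dec 2) = g (dec 2))
    (h3 : f (dec 4) = g (dec 4)) (h4 : f (dec 16) = g (dec 16)) : f = g := by
  ext1 u
  obtain ⟨n, -, rfl⟩ := dec_surj u
  rw [map_dec f, map_dec g, h1, h2, h3, h4]

theorem lift4_g1 (a b c d : G) (ha hb hc hd) : lift4 a b c d ha hb hc hd (dec 1) = a := by
  rw [lift4_dec]; simp
theorem lift4_g2 (a b c d : G) (ha hb hc hd) : lift4 a b c d ha hb hc hd (dec 2) = b := by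
  rw [lift4_dec]; simp
theorem lift4_g3 (a b c d : G) (ha hb hc hd) : lift4 a b c d ha hb hc hd (dec 4) = c := by
  rw [lift4_dec]; simp
theorem lift4_g4 (a b c d : G) (ha hb hc hd) : lift4 a b c d ha hb hc hd (dec 16) = d := by
  rw [lift4_dec]; simp
end lift

theorem four_A (u : A) : 4 • u = 0 := by revert u; decide +kernel

structure Tab where
  aa : ℕ
  ab : ℕ
  ac : ℕ
  ad : ℕ
  bb : ℕ
  bc : ℕ
  bd : ℕ
  cc : ℕ
  cd : ℕ
  dd : ℕ

def Tab.mul (t : Tab) (u v : ℕ) : ℕ :=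
  lin (lin t.aa t.ab t.ac t.ad v) (lin t.ab t.bb t.bc t.bd v) (lin t.ac t.bc t.cc t.cd v)
    (lin t.ad t.bd t.cd t.dd v) u

def Tab.circ (t : Tab) (u v : ℕ) : ℕ := addc (addc u v) (t.mul u v)

/-- the code has additive order dividing two -/
def dz (n : ℕ) : Bool := Nat.beq (n / 4 % 2) 0 && Nat.beq (n / 16 % 2) 0

theorem dz_iff (n : ℕ) : dz n = true ↔ 2 • dec n = 0 := by
  have key : ∀ m : ℕ, 2 * (m : ZMod 4) = 0 ↔ m % 2 = 0 := by
    intro m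
    have : (2 * (m : ZMod 4)) = ((2 * m : ℕ) : ZMod 4) := by push_cast; rfl
    rw [this, ZMod.natCast_eq_zero_iff]; omega
  have k2 : ∀ z : ZMod 2, 2 * z = 0 := by decide
  simp [dz, dec, Prod.ext_iff, nsmul_eq_mul, key, k2]

def Tab.wf (t : Tab) : Bool :=
  dz t.aa && (dz t.ab && (dz t.ac && (dz t.ad && (dz t.bb && (dz t.bc && dz t.bd)))))

structure Tab.WF (t : Tab) : Prop where
  aa : 2 • dec t.aa = 0
  ab : 2 • dec t.ab = 0
  ac : 2 • dec t.ac = 0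
  ad : 2 • dec t.ad = 0
  bb : 2 • dec t.bb = 0
  bc : 2 • dec t.bc = 0
  bd : 2 • dec t.bd = 0

theorem Tab.wf_iff (t : Tab) : t.wf = true ↔ t.WF := by
  simp only [Tab.wf, Bool.and_eq_true, dz_iff]
  constructor
  · rintro ⟨h1, h2, h3, h4, h5, h6, h7⟩; exact ⟨h1, h2, h3, h4, h5, h6, h7⟩
  · rintro ⟨h1, h2, h3, h4, h5, h6, h7⟩; exact ⟨h1, h2, h3, h4, h5, h6, h7⟩

def Tab.r0 (t : Tab) (h : t.WF) : A →+ A :=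
  lift4 (dec t.aa) (dec t.ab) (dec t.ac) (dec t.ad) h.aa h.ab (four_A _) (four_A _)
def Tab.r1 (t : Tab) (h : t.WF) : A →+ A :=
  lift4 (dec t.ab) (dec t.bb) (dec t.bc) (dec t.bd) h.ab h.bb (four_A _) (four_A _)
def Tab.r2 (t : Tab) (h : t.WF) : A →+ A :=
  lift4 (dec t.ac) (dec t.bc) (dec t.cc) (dec t.cd) h.ac h.bc (four_A _) (four_A _)
def Tab.r3 (t : Tab) (h : t.WF) : A →+ A :=
  lift4 (dec t.ad) (dec t.bd) (dec t.cd) (dec t.dd) h.ad h.bd (four_A _) (four_A _)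

/-- the bilinear product on `A` with structure constants `t` -/
def Tab.mu (t : Tab) (h : t.WF) : A →+ A →+ A :=
  lift4 (t.r0 h) (t.r1 h) (t.r2 h) (t.r3 h)
    (by apply hom_ext4 <;> simp [Tab.r0, lift4_g1, lift4_g2, lift4_g3, lift4_g4, h.aa, h.ab, h.ac, h.ad])
    (by apply hom_ext4 <;> simp [Tab.r1, lift4_g1, lift4_g2, lift4_g3, lift4_g4, h.ab, h.bb, h.bc, h.bd])
    (by ext1 u; exact four_A (t.r2 h u)) (by ext1 u; exact four_A (t.r3 h u))

theorem Tab.mu_dec (t : Tab) (h : t.WF) (u v : ℕ) : t.mu h (dec u) (dec v) = dec (t.mul u v) := by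
  rw [Tab.mu, lift4_dec, Tab.mul, dec_lin, dec_lin, dec_lin, dec_lin, dec_lin]
  simp only [AddMonoidHom.add_apply, AddMonoidHom.nsmul_apply, Tab.r0, Tab.r1, Tab.r2, Tab.r3, lift4_dec]

theorem Tab.mul_mod (t : Tab) (u v : ℕ) : t.mul u v < 64 := by
  unfold Tab.mul lin enc; omega
end BB

namespace BB
def n2 : List ℕ := [0,1,2,3,8,9,10,11,32,33,34,35,40,41,42,43]
def n4 : List ℕ := [0,8,32,40]
def n8 : List ℕ := [0,1,8,9,32,33,40,41]

theorem dz_n2 : ∀ n < 64, dz n = true → n ∈ n2 := by decide +kernel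

def tI1B (p : ℕ) : Tab :=
  let X := fun v => lin 2 p 16 1 v
  ⟨X (X (X 1)), X (X (X 2)), X 1, X (X 1), X (X (X (X 2))), X 2, X (X 2), 16, X 16, X (X 16)⟩
def tI1A (q p bb : ℕ) : Tab :=
  let X := fun v => lin q p 16 1 v
  ⟨X (X (X 1)), X (X (X 2)), X 1, X (X 1), bb, X 2, X (X 2), 16, X 16, X (X 16)⟩
def tI2i (c3 p aa : ℕ) : Tab :=
  let X := fun v => lin 2 p 16 c3 v
  ⟨aa, X aa, X 1, X (X 1), X (X aa), X 2, X (X 2), 16, X 16, X (X 16)⟩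
def tI2ii (c3 q p aa bb ab : ℕ) : Tab :=
  let X := fun v => lin q p 16 c3 v
  ⟨aa, ab, X 1, X (X 1), bb, X 2, X (X 2), 16, X 16, X (X 16)⟩
def tII2 (x4 p h : ℕ) : Tab :=
  let X := fun v => lin 2 x4 1 p v
  ⟨X (X 1), X (X 2), X 1, X (X 16), X (X (X 2)), X 2, X (X (X 16)), 1, X 16, addc 32 h⟩

def candI1B : List Tab := n2.map tI1B
def candI1A : List Tab := n8.flatMap fun q => n2.flatMap fun p =>
  [0, addc 32 (lin q p 16 1 (lin q p 16 1 16))].map fun bb => tI1A q p bb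
def candI2i : List Tab := [0,32].flatMap fun c3 => n2.flatMap fun p =>
  [0, 32].map fun aa => tI2i c3 p aa
def candI2ii : List Tab := [0,32].flatMap fun c3 => n4.flatMap fun q => n4.flatMap fun p =>
  [0, 32].flatMap fun aa => [0, 32].flatMap fun bb => n2.map fun ab => tI2ii c3 q p aa bb ab
def candII2 : List Tab := [8,32,40].flatMap fun x4 => (List.range 64).flatMap fun p =>
  [0, 9, x4, addc (addc 9 x4) (lin 2 x4 1 p (lin 2 x4 1 p (lin 2 x4 1 p (lin 2 x4 1 p 9))))].map fun h =>
    tII2 x4 p h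

def fam : List Tab := candI1B ++ candI1A ++ candI2i ++ candI2ii ++ candII2

variable {R : Type*} [CommRing R] {N : AddSubgroup R} {x : R}

structure Ctx (N : AddSubgroup R) (x : R) (e0 : A →+ R) : Prop where
  mul_mem : ∀ {u v}, u ∈ N → v ∈ N → u * v ∈ N
  inj : Function.Injective e0
  ran : ∀ u, u ∈ N ↔ ∃ a, e0 a = u
  xN : x ∈ N
  y0 : 2 * x ^ 2 + x ^ 4 ≠ 0
  sq : ∀ u ∈ N, 2 * u + u ^ 2 = 0 ∨ 2 * u + u ^ 2 = 2 * x + x ^ 2 ∨ 2 * u + u ^ 2 = 2 * x ^ 2 + x ^ 4 ∨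
    2 * u + u ^ 2 = (2 * x + x ^ 2) + (2 * x ^ 2 + x ^ 4) + (2 * x + x ^ 2) * (2 * x ^ 2 + x ^ 4)
  nilp : ∀ u ∈ N, u ^ 16 = 0

structure Rep (e : A →+ R) (t : Tab) : Prop where
  aa : e (dec t.aa) = e (dec 1) * e (dec 1)
  ab : e (dec t.ab) = e (dec 1) * e (dec 2)
  ac : e (dec t.ac) = e (dec 1) * e (dec 4)
  ad : e (dec t.ad) = e (dec 1) * e (dec 16)
  bb : e (dec t.bb) = e (dec 2) * e (dec 2)
  bc : e (dec t.bc) = e (dec 2) * e (dec 4)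
  bd : e (dec t.bd) = e (dec 2) * e (dec 16)
  cc : e (dec t.cc) = e (dec 4) * e (dec 4)
  cd : e (dec t.cd) = e (dec 4) * e (dec 16)
  dd : e (dec t.dd) = e (dec 16) * e (dec 16)

theorem Rep.mul {e : A →+ R} {t : Tab} (h : Rep e t) (u v : ℕ) :
    e (dec (t.mul u v)) = e (dec u) * e (dec v) := by
  rw [Tab.mul, map_lin, map_lin, map_lin, map_lin, map_lin, map_dec e u, map_dec e v]
  rw [h.aa, h.ab, h.ac, h.ad, h.bb, h.bc, h.bd, h.cc, h.cd, h.dd]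
  simp only [nsmul_eq_mul]
  ring

structure Bas (e : A →+ R) (N : AddSubgroup R) : Prop where
  inj : Function.Injective e
  ran : ∀ u, u ∈ N ↔ ∃ a, e a = u

def S4 (c d u : R) : Prop := u = 0 ∨ u = 2 * c ∨ u = 2 * d ∨ u = 2 * c + 2 * d

namespace Ctx
variable {e0 : A →+ R} (C : Ctx N x e0)
include C

theorem four {u : R} (h : u ∈ N) : 4 * u = 0 := by
  obtain ⟨a, rfl⟩ := (C.ran u).1 h
  have := congrArg e0 (four_A a)
  rw [map_nsmul, nsmul_eq_mul, map_zero] at this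
  exact_mod_cast this

theorem nil {v t : R} (ht : t ∈ N) (h : v = v * t) : v = 0 := by
  have h2 : v = v * t ^ 16 := by
    have h1 : v = v * t ^ 2 := by linear_combination (1 + t) * h
    have h1 : v = v * t ^ 4 := by linear_combination (1 + t ^ 2) * h1
    have h1 : v = v * t ^ 8 := by linear_combination (1 + t ^ 4) * h1
    linear_combination (1 + t ^ 8) * h1
  rw [h2, C.nilp t ht, mul_zero]

theorem mod2 {u t z : R} (ht : t ∈ N) (hz : z ∈ N) (h : u - u * t = 2 * z) : ∃ z ∈ N, u = 2 * z := by
  have m : ∀ {z w}, z ∈ N → w ∈ N → z * (1 + w) ∈ N := by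
    intro z w hz hw
    have := N.add_mem hz (C.mul_mem hz hw)
    rwa [mul_add, mul_one]
  have t2 := C.mul_mem ht ht
  have t4 := C.mul_mem t2 t2
  have t8 := C.mul_mem t4 t4
  refine ⟨_, m (m (m (m hz ht) t2) t4) t8, ?_⟩
  have := C.nilp t ht
  linear_combination ((1 + t) * (1 + t * t) * (1 + t * t * (t * t)) * (1 + t * t * (t * t) * (t * t * (t * t)))) * h
    + u * this

theorem basis {a b c d : R} (ha : a ∈ N) (hb : b ∈ N) (hc : c ∈ N) (hd : d ∈ N) (a2 : 2 * a = 0) (b2 : 2 * b = 0)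
    (h1 : 2 * c ≠ 0) (h2 : 2 * d ≠ 0) (h3 : 2 * c + 2 * d ≠ 0) (ha' : ¬ S4 c d a) (hb' : ¬ S4 c d b)
    (hab : ¬ S4 c d (a + b)) :
    ∃ e : A →+ R, Bas e N ∧ e (dec 1) = a ∧ e (dec 2) = b ∧ e (dec 4) = c ∧ e (dec 16) = d := by
  have c4 := C.four hc
  have d4 := C.four hd
  let e : A →+ R := lift4 a b c d (by rw [nsmul_eq_mul]; exact_mod_cast a2) (by rw [nsmul_eq_mul]; exact_mod_cast b2)
    (by rw [nsmul_eq_mul]; exact_mod_cast c4) (by rw [nsmul_eq_mul]; exact_mod_cast d4)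
  have e1 : e (dec 1) = a := lift4_g1 ..
  have e2 : e (dec 2) = b := lift4_g2 ..
  have e3 : e (dec 4) = c := lift4_g3 ..
  have e4 : e (dec 16) = d := lift4_g4 ..
  have inj : Function.Injective e := by
    rw [injective_iff_map_eq_zero]
    have soc : ∀ u : A, 2 • u = 0 → e u = 0 → u = 0 := by
      intro u hu he
      obtain ⟨n, hn, rfl⟩ := dec_surj u
      have hn2 : n ∈ n2 := by
        have := (dz_iff n).2 hu
        exact dz_n2 n hn this
      rw [map_dec, e1, e2, e3, e4] at he
      simp only [S4, not_or] at ha' hb' hab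
      obtain ⟨p0, p1, p2, p3⟩ := ha'
      obtain ⟨q0, q1, q2, q3⟩ := hb'
      obtain ⟨r0, r1, r2, r3⟩ := hab
      simp only [n2, List.mem_cons, List.not_mem_nil, or_false] at hn2
      rcases hn2 with rfl | rfl | rfl | rfl | rfl | rfl | rfl | rfl | rfl | rfl | rfl | rfl | rfl | rfl | rfl | rfl <;>
        norm_num at he
      · rfl
      · exact absurd he p0
      · exact absurd he q0
      · exact absurd he r0
      · exact absurd he h1
      · exact absurd (by linear_combination he - c4) p1
      · exact absurd (by linear_combination he - c4) q1
      · exact absurd (by linear_combination he - c4) r1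
      · exact absurd he h2
      · exact absurd (by linear_combination he - d4) p2
      · exact absurd (by linear_combination he - d4) q2
      · exact absurd (by linear_combination he - d4) r2
      · exact absurd he h3
      · exact absurd (by linear_combination he - d4 - c4) p3
      · exact absurd (by linear_combination he - d4 - c4) q3
      · exact absurd (by linear_combination he - d4 - c4) r3
    intro u hu
    apply soc u _ hu
    apply soc
    · rw [smul_smul]; exact four_A u
    · rw [map_nsmul, hu, smul_zero]
  refine ⟨e, ⟨inj, ?_⟩, e1, e2, e3, e4⟩
  have sub : ∀ u, e u ∈ N := by
    intro u
    obtain ⟨n, -, rfl⟩ := dec_surj u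
    rw [map_dec, e1, e2, e3, e4]
    exact N.add_mem (N.add_mem (N.add_mem (N.nsmul_mem ha _) (N.nsmul_mem hb _)) (N.nsmul_mem hc _)) (N.nsmul_mem hd _)
  have h0 : Set.range e0 = N := by ext u; exact (C.ran u).symm
  have h1 : Set.range e ⊆ Set.range e0 := by
    rw [h0]; rintro _ ⟨u, rfl⟩; exact sub u
  have h2 : Set.range e = Set.range e0 := by
    classical
    apply Set.eq_of_subset_of_ncard_le h1
    rw [Set.ncard_eq_toFinset_card', Set.ncard_eq_toFinset_card', Set.toFinset_range, Set.toFinset_range,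
      Finset.card_image_of_injective _ inj, Finset.card_image_of_injective _ C.inj]
  intro u
  rw [← SetLike.mem_coe, ← h0, ← h2]; rfl

theorem compl (l : List R) (hl : l.length < 16) : ∃ b ∈ N, 2 * b = 0 ∧ b ∉ l := by
  classical
  by_contra! H
  let s : Finset ℕ := n2.toFinset
  have : (s.image (fun n => e0 (dec n))) ⊆ l.toFinset := by
    intro u hu
    simp only [Finset.mem_image] at hu
    obtain ⟨n, hn, rfl⟩ := hu
    rw [List.mem_toFinset]
    apply H _ ((C.ran _).2 ⟨_, rfl⟩)
    have : 2 • dec n = 0 := by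
      rw [← dz_iff]
      revert n; decide +kernel
    have := congrArg e0 this
    rw [map_nsmul, nsmul_eq_mul, map_zero] at this
    exact_mod_cast this
  have h2 := Finset.card_le_card this
  rw [Finset.card_image_of_injOn] at h2
  · have h3 : s.card = 16 := by decide +kernel
    have := List.toFinset_card_le l
    omega
  · intro m hm n hn h
    have hlt : ∀ k ∈ s, k < 64 := by decide +kernel
    exact dec_inj (hlt m hm) (hlt n hn) (C.inj h)

theorem compl1 (c d a : R) (ha : 2 * a = 0) : ∃ b ∈ N, 2 * b = 0 ∧ ¬ S4 c d b ∧ ¬ S4 c d (a + b) := by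
  obtain ⟨b, hb, b2, h⟩ := C.compl [0, 2 * c, 2 * d, 2 * c + 2 * d, a, a + 2 * c, a + 2 * d, a + (2 * c + 2 * d)]
    (by simp)
  simp only [List.mem_cons, List.not_mem_nil, or_false, not_or] at h
  obtain ⟨h1, h2, h3, h4, h5, h6, h7, h8⟩ := h
  refine ⟨b, hb, b2, ?_, ?_⟩
  · rintro (h | h | h | h) <;> contradiction
  · rintro (h | h | h | h)
    · exact h5 (by linear_combination h - ha)
    · exact h6 (by linear_combination h - ha)
    · exact h7 (by linear_combination h - ha)
    · exact h8 (by linear_combination h - ha)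

theorem two_mem {c d : R} (hc : c ∈ N) (hd : d ∈ N)
    (h1 : 2 * c ≠ 0) (h2 : 2 * d ≠ 0) (h3 : 2 * c + 2 * d ≠ 0) {u : R} (hu : u ∈ N) : S4 c d (2 * u) := by
  obtain ⟨a, ha, a2, ha', -⟩ := C.compl1 c d 0 (by simp)
  obtain ⟨b, hb, b2, hb', hab⟩ := C.compl1 c d a a2
  obtain ⟨e, he, e1, e2, e3, e4⟩ := C.basis ha hb hc hd a2 b2 h1 h2 h3 ha' hb' hab
  obtain ⟨n, rfl⟩ := (he.ran u).1 hu
  obtain ⟨n, hn, rfl⟩ := dec_surj n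
  rw [map_dec, e1, e2, e3, e4]
  simp only [nsmul_eq_mul]
  have i2 : ∀ m : ℕ, (2 * ((m % 4 : ℕ) : R) * c = 0 ∨ 2 * ((m % 4 : ℕ) : R) * c = 2 * c) := by
    intro m
    have c4 := C.four hc
    have : m % 4 < 4 := Nat.mod_lt _ (by norm_num)
    interval_cases m % 4
    · left; simp
    · right; simp
    · left; push_cast; linear_combination c4
    · right; push_cast; linear_combination c4
  have i3 : ∀ m : ℕ, (2 * ((m % 4 : ℕ) : R) * d = 0 ∨ 2 * ((m % 4 : ℕ) : R) * d = 2 * d) := by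
    intro m
    have c4 := C.four hd
    have : m % 4 < 4 := Nat.mod_lt _ (by norm_num)
    interval_cases m % 4
    · left; simp
    · right; simp
    · left; push_cast; linear_combination c4
    · right; push_cast; linear_combination c4
  generalize ((n % 2 : ℕ) : R) = i
  generalize ((n / 2 % 2 : ℕ) : R) = j
  rcases i2 (n / 4) with k | k <;> rcases i3 (n / 16) with l | l
  · left; linear_combination i * a2 + j * b2 + k + l
  · right; right; left; linear_combination i * a2 + j * b2 + k + l
  · right; left; linear_combination i * a2 + j * b2 + k + l
  · right; right; right; linear_combination i * a2 + j * b2 + k + l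
end Ctx

theorem Bas.code {e : A →+ R} (h : Bas e N) {u : R} (hu : u ∈ N) : ∃ n ∈ List.range 64, e (dec n) = u := by
  obtain ⟨n, rfl⟩ := (h.ran u).1 hu
  obtain ⟨n, hn, rfl⟩ := dec_surj n
  exact ⟨n, List.mem_range.2 hn, rfl⟩

theorem Bas.code2 {e : A →+ R} (h : Bas e N) {u : R} (hu : u ∈ N) (h2 : 2 * u = 0) :
    ∃ n ∈ n2, e (dec n) = u := by
  obtain ⟨n, hn, rfl⟩ := h.code hu
  refine ⟨n, ?_, rfl⟩
  have : 2 • dec n = 0 := by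
    apply h.inj
    rw [map_nsmul, nsmul_eq_mul, map_zero]; exact_mod_cast h2
  have := (dz_iff n).2 this
  exact dz_n2 n (List.mem_range.1 hn) this

theorem e_eight (e : A →+ R) : e (dec 8) = 2 * e (dec 4) := by rw [map_dec]; norm_num
theorem e_32 (e : A →+ R) : e (dec 32) = 2 * e (dec 16) := by rw [map_dec]; norm_num
theorem e_40 (e : A →+ R) : e (dec 40) = 2 * e (dec 4) + 2 * e (dec 16) := by rw [map_dec]; norm_num

theorem S4.code {e : A →+ R} {u : R} (h : S4 (e (dec 4)) (e (dec 16)) u) : ∃ n ∈ n4, e (dec n) = u := by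
  rcases h with rfl | rfl | rfl | rfl
  · exact ⟨0, by decide, by rw [dec_zero, map_zero]⟩
  · exact ⟨8, by decide, e_eight e⟩
  · exact ⟨32, by decide, e_32 e⟩
  · exact ⟨40, by decide, e_40 e⟩
theorem lin_mul {e : A →+ R} {m0 m1 m2 m3 : ℕ} {x : R} (h0 : e (dec m0) = x * e (dec 1)) (h1 : e (dec m1) = x * e (dec 2))
    (h2 : e (dec m2) = x * e (dec 4)) (h3 : e (dec m3) = x * e (dec 16)) (v : ℕ) :
    e (dec (lin m0 m1 m2 m3 v)) = x * e (dec v) := by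
  rw [map_lin, map_dec e v, h0, h1, h2, h3]
  simp only [nsmul_eq_mul]
  ring
end BB

namespace BB
variable {R : Type*} [CommRing R] {N : AddSubgroup R} {x : R} {e0 : A →+ R}

def Goal (N : AddSubgroup R) (x : R) (l : List Tab) : Prop :=
  ∃ t ∈ l, ∃ e : A →+ R, Bas e N ∧ e (dec 4) = x ∧ Rep e t

section caseI
variable (C : Ctx N x e0) (hx : 2 * x ^ 2 ≠ 0)
include C hx

theorem I_base : 2 * x ≠ 0 ∧ 2 * x + 2 * x ^ 2 ≠ 0 ∧ 2 * x ^ 3 = 0 := by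
  have xN := C.xN
  have x2N : x ^ 2 ∈ N := by rw [pow_two]; exact C.mul_mem xN xN
  have h1 : 2 * x ≠ 0 := fun h => hx (by linear_combination x * h)
  have h3 : 2 * x + 2 * x ^ 2 ≠ 0 := fun h => h1 (C.nil (N.neg_mem xN) (by linear_combination h))
  refine ⟨h1, h3, ?_⟩
  have x3N : x ^ 3 ∈ N := by rw [pow_succ]; exact C.mul_mem x2N xN
  rcases C.two_mem xN x2N h1 hx h3 x3N with h | h | h | h
  · exact h
  · exact absurd (C.nil x2N (by linear_combination -h)) h1
  · exact absurd (C.nil xN (by linear_combination -h)) hx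
  · exact absurd (C.nil (N.sub_mem x2N xN) (by linear_combination -h)) h1

theorem I_sq {u : R} (hu : u ∈ N) (h2 : 2 * u = 0) : u * u = 0 ∨ u * u = 2 * x ^ 2 + x ^ 4 := by
  obtain ⟨h1, h3, x3⟩ := I_base C hx
  have x4 := C.four C.xN
  rcases C.sq u hu with h | h | h | h
  · left; linear_combination h - h2
  · exfalso; apply hx; linear_combination -2 * h + (2 + u) * h2 - x4
  · right; linear_combination h - h2
  · exfalso; apply hx
    linear_combination -2 * h + (2 + u) * h2 - x4 - x * x4 - (x + 4 + 2 * x + 2*x^2+x^3) * x3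

theorem I1 (hxx : ¬ S4 x (x ^ 2) (x ^ 3)) : Goal N x candI1B ∨ Goal N x candI1A := by
  obtain ⟨h1, h3, x3⟩ := I_base C hx
  have xN := C.xN
  have x2N : x ^ 2 ∈ N := by rw [pow_two]; exact C.mul_mem xN xN
  have x3N : x ^ 3 ∈ N := by rw [pow_succ]; exact C.mul_mem x2N xN
  have x4N : x ^ 4 ∈ N := by rw [pow_succ]; exact C.mul_mem x3N xN
  have x5N : x ^ 5 ∈ N := by rw [pow_succ]; exact C.mul_mem x4N xN
  have z4 : 2 * x ^ 4 = 0 := by linear_combination x * x3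
  by_cases hB : ¬ S4 x (x ^ 2) (x ^ 4) ∧ ¬ S4 x (x ^ 2) (x ^ 3 + x ^ 4)
  · left
    obtain ⟨e, he, e1, e2, e3, e4⟩ := C.basis x3N x4N xN x2N x3 z4 h1 hx h3 hxx hB.1 hB.2
    obtain ⟨p, hp, ep⟩ := he.code2 x5N (by linear_combination x^2 * x3)
    refine ⟨tI1B p, List.mem_map.2 ⟨p, hp, rfl⟩, e, he, e3, ?_⟩
    have X := lin_mul (e := e) (m0 := 2) (m1 := p) (m2 := 16) (m3 := 1) (x := x)
      (by rw [e1, e2]; ring) (by rw [ep, e2]; ring) (by rw [e3, e4]; ring) (by rw [e1, e4]; ring)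
    constructor <;> simp only [tI1B, X] <;> simp only [e1, e2, e3, e4] <;> ring
  · right
    obtain ⟨b, hb, b2, hb', hab⟩ := C.compl1 x (x ^ 2) (x ^ 3) x3
    obtain ⟨e, he, e1, e2, e3, e4⟩ := C.basis x3N hb xN x2N x3 b2 h1 hx h3 hxx hb' hab
    obtain ⟨q, hq, eq⟩ : ∃ q ∈ n8, e (dec q) = x ^ 4 := by
      have hB : S4 x (x ^ 2) (x ^ 4) ∨ S4 x (x ^ 2) (x ^ 3 + x ^ 4) := by
        by_contra h; exact hB (not_or.1 h)
      rcases hB with hB | hB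
      · rw [← e4] at hB; nth_rw 1 [← e3] at hB
        obtain ⟨q, hq, eq⟩ := hB.code
        refine ⟨q, ?_, eq⟩
        revert hq; exact (show ∀ q, q ∈ n4 → q ∈ n8 by decide) q
      · have : ∀ u, x ^ 3 + x ^ 4 = u → x ^ 4 = x ^ 3 + u := by
          intro u hu; linear_combination hu - x3
        rcases hB with h | h | h | h <;> rw [this _ h]
        · exact ⟨1, by decide, by rw [e1]; ring⟩
        · exact ⟨9, by decide, by rw [map_dec, e1, e3]; norm_num⟩
        · exact ⟨33, by decide, by rw [map_dec, e1, e4]; norm_num⟩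
        · exact ⟨41, by decide, by rw [map_dec, e1, e3, e4]; norm_num; ring⟩
    obtain ⟨p, hp, ep⟩ := he.code2 (C.mul_mem xN hb) (by linear_combination x * b2)
    have X := lin_mul (e := e) (m0 := q) (m1 := p) (m2 := 16) (m3 := 1) (x := x)
      (by rw [e1, eq]; ring) (by rw [ep, e2]) (by rw [e3, e4]; ring) (by rw [e1, e4]; ring)
    obtain ⟨bb, hbb, ebb⟩ : ∃ bb ∈ [0, addc 32 (lin q p 16 1 (lin q p 16 1 16))], e (dec bb) = b * b := by
      rcases I_sq C hx hb b2 with h | h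
      · exact ⟨0, by simp, by rw [dec_zero, map_zero, h]⟩
      · refine ⟨_, by simp only [List.mem_cons]; right; left; rfl, ?_⟩
        rw [dec_addc, map_add, X, X, e_32, e4, h]; ring
    refine ⟨tI1A q p bb, List.mem_flatMap.2 ⟨q, hq, List.mem_flatMap.2 ⟨p, hp, List.mem_map.2 ⟨bb, hbb, rfl⟩⟩⟩, e, he, e3, ?_⟩
    constructor <;> simp only [tI1A, X] <;> (try rw [ebb]) <;> simp only [e1, e2, e3, e4] <;> ring

theorem I2 (hxx : S4 x (x ^ 2) (x ^ 3)) : Goal N x candI2i ∨ Goal N x candI2ii := by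
  obtain ⟨h1, h3, x3⟩ := I_base C hx
  have xN := C.xN
  have x2N : x ^ 2 ∈ N := by rw [pow_two]; exact C.mul_mem xN xN
  have f1 := C.four xN
  have f2 := C.four x2N
  have hc : x ^ 3 = 0 ∨ x ^ 3 = 2 * x ^ 2 := by
    rcases hxx with h | h | h | h
    · exact Or.inl h
    · exfalso; apply C.y0; linear_combination x * h + f2
    · exact Or.inr h
    · exfalso; apply C.y0; linear_combination x * h + f2 + x3
  have z4 : x ^ 4 = 0 := by
    rcases hc with h | h
    · linear_combination x * h
    · linear_combination x * h + x3
  obtain ⟨c3, hc3, ec3⟩ : ∃ c3 ∈ [0, 32], ∀ e : A →+ R, e (dec 16) = x ^ 2 → e (dec c3) = x ^ 3 := by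
    rcases hc with h | h
    · exact ⟨0, by simp, fun e he => by rw [dec_zero, map_zero, h]⟩
    · exact ⟨32, by simp, fun e he => by rw [e_32, h, he]⟩
  have sqc : ∀ e : A →+ R, e (dec 16) = x ^ 2 → ∀ u ∈ N, 2 * u = 0 → ∃ n ∈ [0, 32], e (dec n) = u * u := by
    intro e he u hu h2
    rcases I_sq C hx hu h2 with h | h
    · exact ⟨0, by simp, by rw [dec_zero, map_zero, h]⟩
    · exact ⟨32, by simp, by rw [e_32, he, h, z4, add_zero]⟩
  by_cases hi : ∃ a ∈ N, 2 * a = 0 ∧ ¬ S4 x (x ^ 2) (x * a)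
  · left
    obtain ⟨a, ha, a2, hax⟩ := hi
    have hb := C.mul_mem xN ha
    have b2 : 2 * (x * a) = 0 := by linear_combination x * a2
    have ha' : ¬ S4 x (x ^ 2) a := by
      rintro (h | h | h | h) <;> apply hax <;> rw [h]
      · left; ring
      · right; right; left; ring
      · left; linear_combination x3
      · right; right; left; linear_combination x3
    have hab : ¬ S4 x (x ^ 2) (a + x * a) := by
      intro hh
      have hz : x * (a + x * a) = 0 ∨ x * (a + x * a) = 2 * x ^ 2 := by
        rcases hh with h | h | h | h
        · left; rw [h, mul_zero]
        · right; linear_combination x * h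
        · left; linear_combination x * h + x3
        · right; linear_combination x * h + x3
      have q3 : a * x ^ 3 = 0 := by
        rcases hc with h | h
        · rw [h, mul_zero]
        · linear_combination a * h + x ^ 2 * a2
      have q2 : a * x ^ 2 = 0 := by
        rcases hz with h | h
        · linear_combination x * h - q3
        · linear_combination x * h - q3 + x3
      apply hax
      rcases hz with h | h
      · left; linear_combination h - q2
      · right; right; left; linear_combination h - q2
    obtain ⟨e, he, e1, e2, e3, e4⟩ := C.basis ha hb xN x2N a2 b2 h1 hx h3 ha' hax hab
    obtain ⟨p, hp, ep⟩ := he.code2 (C.mul_mem xN hb) (by linear_combination x * b2)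
    obtain ⟨aa, haa, eaa⟩ := sqc e e4 a ha a2
    have X := lin_mul (e := e) (m0 := 2) (m1 := p) (m2 := 16) (m3 := c3) (x := x)
      (by rw [e1, e2]) (by rw [ep, e2]) (by rw [e3, e4]; ring) (by rw [ec3 e e4, e4]; ring)
    refine ⟨tI2i c3 p aa, List.mem_flatMap.2 ⟨c3, hc3, List.mem_flatMap.2 ⟨p, hp, List.mem_map.2 ⟨aa, haa, rfl⟩⟩⟩, e, he, e3, ?_⟩
    constructor <;> simp only [tI2i, X] <;> (try rw [eaa]) <;> simp only [e1, e2, e3, e4] <;> ring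
  · right
    have hs : ∀ a ∈ N, 2 * a = 0 → S4 x (x ^ 2) (x * a) := by
      intro a ha a2; by_contra h; exact hi ⟨a, ha, a2, h⟩
    obtain ⟨a, ha, a2, ha', -⟩ := C.compl1 x (x ^ 2) 0 (by simp)
    obtain ⟨b, hb, b2, hb', hab⟩ := C.compl1 x (x ^ 2) a a2
    obtain ⟨e, he, e1, e2, e3, e4⟩ := C.basis ha hb xN x2N a2 b2 h1 hx h3 ha' hb' hab
    obtain ⟨q, hq, eq⟩ : ∃ q ∈ n4, e (dec q) = x * a := by
      have := hs a ha a2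
      rw [← e4] at this; nth_rw 1 [← e3] at this; exact this.code
    obtain ⟨p, hp, ep⟩ : ∃ q ∈ n4, e (dec q) = x * b := by
      have := hs b hb b2
      rw [← e4] at this; nth_rw 1 [← e3] at this; exact this.code
    obtain ⟨aa, haa, eaa⟩ := sqc e e4 a ha a2
    obtain ⟨bb, hbb, ebb⟩ := sqc e e4 b hb b2
    obtain ⟨ab, hab, eab⟩ := he.code2 (C.mul_mem ha hb) (by linear_combination b * a2)
    have X := lin_mul (e := e) (m0 := q) (m1 := p) (m2 := 16) (m3 := c3) (x := x)
      (by rw [e1, eq]) (by rw [ep, e2]) (by rw [e3, e4]; ring) (by rw [ec3 e e4, e4]; ring)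
    refine ⟨tI2ii c3 q p aa bb ab, List.mem_flatMap.2 ⟨c3, hc3, List.mem_flatMap.2 ⟨q, hq, List.mem_flatMap.2 ⟨p, hp,
      List.mem_flatMap.2 ⟨aa, haa, List.mem_flatMap.2 ⟨bb, hbb, List.mem_map.2 ⟨ab, hab, rfl⟩⟩⟩⟩⟩⟩, e, he, e3, ?_⟩
    constructor <;> simp only [tI2ii, X] <;> (try first | rw [eaa] | rw [ebb] | rw [eab]) <;> simp only [e1, e2, e3, e4] <;> ring
end caseI

theorem II (C : Ctx N x e0) (hx : 2 * x ^ 2 = 0) : Goal N x candII2 := by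
  have xN := C.xN
  have x2N : x ^ 2 ∈ N := by rw [pow_two]; exact C.mul_mem xN xN
  have x3N : x ^ 3 ∈ N := by rw [pow_succ]; exact C.mul_mem x2N xN
  have x4N : x ^ 4 ∈ N := by rw [pow_succ]; exact C.mul_mem x3N xN
  have y0 : x ^ 4 ≠ 0 := by have := C.y0; rwa [hx, zero_add] at this
  have x30 : x ^ 3 ≠ 0 := fun h => y0 (by linear_combination x * h)
  have f1 := C.four xN
  have hII : ∀ z ∈ N, x ^ 3 ≠ 2 * z := by
    intro z hz h
    have k1 : 2 * z ≠ 0 := h ▸ x30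
    have k2 : 2 * (z * x) ≠ 0 := fun h' => y0 (by linear_combination x * h + h')
    have k3 : 2 * z + 2 * (z * x) ≠ 0 := fun h' => k1 (C.nil (N.neg_mem xN) (by linear_combination h'))
    have h4 : 2 * x = 0 ∨ 2 * x = x ^ 4 := by
      rcases C.two_mem hz (C.mul_mem hz xN) k1 k2 k3 xN with g | g | g | g
      · exact Or.inl g
      · exfalso; apply y0; linear_combination x * h - x * g + hx
      · right; linear_combination g - x * h
      · exfalso; apply y0; linear_combination x * h - x * g + hx - z * hx
    rcases h4 with g | g
    · apply y0; linear_combination x * h + z * g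
    · exact y0 (C.nil hz (by linear_combination x * h + z * g))
  have T3 : ∀ {u : R}, (∃ z ∈ N, u = 2 * z) → x ^ 3 ≠ u := by
    rintro u ⟨z, hz, rfl⟩; exact hII z hz
  have n3 : ¬ ∃ z ∈ N, x ^ 3 = 2 * z := fun ⟨z, hz, h⟩ => hII z hz h
  have n2' : ¬ ∃ z ∈ N, x ^ 2 = 2 * z := fun ⟨z, hz, h⟩ => n3 ⟨z * x, C.mul_mem hz xN, by linear_combination x * h⟩
  have n1 : ¬ ∃ z ∈ N, x = 2 * z := fun ⟨z, hz, h⟩ => n2' ⟨z * x, C.mul_mem hz xN, by linear_combination x * h⟩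
  have n23 : ¬ ∃ z ∈ N, x ^ 2 + x ^ 3 = 2 * z := fun ⟨z, hz, h⟩ =>
    n2' (C.mod2 (N.neg_mem xN) hz (by linear_combination h))
  have S : ∀ {c d u : R}, c ∈ N → d ∈ N → S4 c d u → ∃ z ∈ N, u = 2 * z := by
    rintro c d u hc hd (h | h | h | h)
    · exact ⟨0, N.zero_mem, by rw [h]; ring⟩
    · exact ⟨c, hc, h⟩
    · exact ⟨d, hd, h⟩
    · exact ⟨c + d, N.add_mem hc hd, by rw [h]; ring⟩
  have x32 : 2 * x ^ 3 = 0 := by linear_combination x * hx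
  have span : ∀ {c d : R}, c ∈ N → d ∈ N → 2 * c ≠ 0 → 2 * d ≠ 0 → 2 * c + 2 * d ≠ 0 →
      ∃ e : A →+ R, Bas e N ∧ e (dec 1) = x ^ 2 ∧ e (dec 2) = x ^ 3 ∧ e (dec 4) = c ∧ e (dec 16) = d := by
    intro c d hc hd k1 k2 k3
    exact C.basis x2N x3N hc hd hx x32 k1 k2 k3 (fun h => n2' (S hc hd h)) (fun h => n3 (S hc hd h))
      (fun h => n23 (S hc hd h))
  have sp2 : ∀ {c d u : R}, c ∈ N → d ∈ N → 2 * c ≠ 0 → 2 * d ≠ 0 → 2 * c + 2 * d ≠ 0 → u ∈ N → 2 * u = 0 →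
      ∃ i j, ((i = 0 ∨ i = 1) ∧ (j = 0 ∨ j = 1)) ∧ S4 c d (u - (i * x ^ 2 + j * x ^ 3)) := by
    intro c d u hc hd k1 k2 k3 hu u2
    obtain ⟨e, he, e1, e2, e3, e4⟩ := span hc hd k1 k2 k3
    obtain ⟨p, hp, rfl⟩ := he.code2 hu u2
    have : p = p % 4 + p / 4 * 4 := by omega
    refine ⟨((p % 2 : ℕ) : R), ((p / 2 % 2 : ℕ) : R), ⟨?_, ?_⟩, ?_⟩
    · rcases Nat.mod_two_eq_zero_or_one p with h | h <;> rw [h] <;> simp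
    · rcases Nat.mod_two_eq_zero_or_one (p / 2) with h | h <;> rw [h] <;> simp
    · rw [map_dec, e1, e2, e3, e4]
      simp only [nsmul_eq_mul]
      have : ∀ q ∈ n2, (q / 4 % 4 = 0 ∨ q / 4 % 4 = 2) ∧ (q / 16 % 4 = 0 ∨ q / 16 % 4 = 2) := by decide +kernel
      obtain ⟨h1 | h1, h2 | h2⟩ := this p hp <;> rw [h1, h2]
      · left; push_cast; ring
      · right; right; left; push_cast; ring
      · right; left; push_cast; ring
      · right; right; right; push_cast; ring
  have k0 : ∀ n, 2 • dec n ≠ 0 → 2 * e0 (dec n) ≠ 0 := by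
    intro n hn h
    apply hn; apply C.inj
    rw [map_nsmul, nsmul_eq_mul, map_zero]; exact_mod_cast h
  have kc : 2 * e0 (dec 4) ≠ 0 := k0 4 (by decide)
  have kd : 2 * e0 (dec 16) ≠ 0 := k0 16 (by decide)
  have kcd : 2 * e0 (dec 4) + 2 * e0 (dec 16) ≠ 0 := by
    have := k0 20 (by decide)
    have h : dec 20 = dec 4 + dec 16 := by decide
    rwa [h, map_add, mul_add] at this
  have cN : e0 (dec 4) ∈ N := (C.ran _).2 ⟨_, rfl⟩
  have dN : e0 (dec 16) ∈ N := (C.ran _).2 ⟨_, rfl⟩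
  have hx2 : 2 * x ≠ 0 := by
    intro h
    obtain ⟨i, j, ⟨hi, hj⟩, hs⟩ := sp2 cN dN kc kd kcd xN h
    obtain ⟨z, hz, e⟩ := S cN dN hs
    have hij : i * x + j * x ^ 2 ∈ N := by
      rcases hi with rfl | rfl <;> rcases hj with rfl | rfl <;> simp [N.zero_mem, xN, x2N, N.add_mem]
    exact n1 (C.mod2 hij hz (by linear_combination e))
  obtain ⟨w, wN, w1, w2⟩ : ∃ w ∈ N, 2 * w ≠ 0 ∧ 2 * x + 2 * w ≠ 0 := by
    by_cases h : 2 * x + 2 * e0 (dec 4) = 0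
    · refine ⟨_, dN, kd, fun h' => kcd ?_⟩
      linear_combination h + h' - f1
    · exact ⟨_, cN, kc, h⟩
  obtain ⟨e, he, e1, e2, e3, e4⟩ := span xN wN hx2 w1 w2
  have y4 : S4 x w (x ^ 4) := by
    obtain ⟨i, j, ⟨hi, hj⟩, hs⟩ := sp2 xN wN hx2 w1 w2 x4N (by linear_combination x ^ 2 * hx)
    obtain ⟨z, hz, g⟩ := S xN wN hs
    rcases hi with rfl | rfl <;> rcases hj with rfl | rfl
    · simpa using hs
    · exact absurd (C.mod2 (u := x ^ 3) xN (N.neg_mem hz) (by linear_combination -g)) n3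
    · exact absurd (C.mod2 (u := x ^ 2) x2N (N.neg_mem hz) (by linear_combination -g)) n2'
    · exact absurd (C.mod2 (u := x ^ 2) (N.sub_mem x2N xN) (N.neg_mem hz) (by linear_combination -g)) n2'
  obtain ⟨x4, hx4, ex4⟩ : ∃ x4 ∈ [8, 32, 40], e (dec x4) = x ^ 4 := by
    rcases y4 with h | h | h | h
    · exact absurd h y0
    · exact ⟨8, by simp, by rw [e_eight, e3, h]⟩
    · exact ⟨32, by simp, by rw [e_32, e4, h]⟩
    · exact ⟨40, by simp, by rw [e_40, e3, e4, h]⟩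
  obtain ⟨p, hp, ep⟩ := he.code (C.mul_mem xN wN)
  have X := lin_mul (e := e) (m0 := 2) (m1 := x4) (m2 := 1) (m3 := p) (x := x)
    (by rw [e1, e2]; ring) (by rw [ex4, e2]; ring) (by rw [e1, e3]; ring) (by rw [ep, e4])
  have e9 : e (dec 9) = 2 * x + x ^ 2 := by rw [map_dec, e1, e3]; norm_num; ring
  obtain ⟨h, hh, eh⟩ : ∃ h ∈ [0, 9, x4, addc (addc 9 x4) (lin 2 x4 1 p (lin 2 x4 1 p (lin 2 x4 1 p (lin 2 x4 1 p 9))))],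
      e (dec h) = 2 * w + w ^ 2 := by
    rcases C.sq w wN with h | h | h | h
    · exact ⟨0, by simp, by rw [dec_zero, map_zero, h]⟩
    · exact ⟨9, by simp, by rw [e9, h]⟩
    · exact ⟨x4, by simp, by rw [ex4, h, hx, zero_add]⟩
    · refine ⟨_, by simp only [List.mem_cons]; right; right; right; left; rfl, ?_⟩
      rw [dec_addc, dec_addc, map_add, map_add, X, X, X, X, e9, ex4, h]
      linear_combination (-1 - 2 * x - x ^ 2) * hx
  refine ⟨tII2 x4 p h, List.mem_flatMap.2 ⟨x4, hx4, List.mem_flatMap.2 ⟨p, hp, List.mem_map.2 ⟨h, hh, rfl⟩⟩⟩, e, he, e3, ?_⟩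
  have w4 := C.four wN
  constructor <;> simp only [tII2, X, dec_addc, map_add, e_32, eh] <;> simp only [e1, e2, e3, e4] <;> (try ring1)
  linear_combination w4

theorem classify (C : Ctx N x e0) : Goal N x candI1B ∨ Goal N x candI1A ∨ Goal N x candI2i ∨ Goal N x candI2ii ∨
    Goal N x candII2 := by
  by_cases hx : 2 * x ^ 2 = 0
  · have := II C hx; tauto
  · by_cases h : S4 x (x ^ 2) (x ^ 3)
    · have := I2 C hx h; tauto
    · have := I1 C hx h; tauto
end BB

namespace BB
theorem beq_iff' {m n : ℕ} : Nat.beq m n = true ↔ m = n := ⟨Nat.eq_of_beq_eq_true, fun h => h ▸ Nat.beq_refl m⟩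

def asc (t : Tab) (q : ℕ × ℕ × ℕ) : Bool :=
  Nat.beq (t.mul (t.mul q.1 q.2.1) q.2.2) (t.mul q.1 (t.mul q.2.1 q.2.2))

def sqt (t : Tab) : Bool :=
  let s := t.circ 4 4
  let y := t.circ s s
  let c := t.circ 5 5
  !(Nat.beq y 0) && (Nat.beq c 0 || (Nat.beq c s || (Nat.beq c y || Nat.beq c (t.circ s y))))

def ok (b : Bool) (T : List (ℕ × ℕ × ℕ)) (t : Tab) : Bool :=
  t.wf && ((b || sqt t) && T.all (asc t))

theorem addc_lt (u v : ℕ) : addc u v < 64 := by unfold addc enc; omega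
theorem lin_lt (a b c d v : ℕ) : lin a b c d v < 64 := by unfold lin enc; omega

section
variable {R : Type*} [CommRing R] {N : AddSubgroup R} {x : R} {e0 : A →+ R}

theorem Rep.circ {e : A →+ R} {t : Tab} (h : Rep e t) (u v : ℕ) :
    e (dec (t.circ u v)) = e (dec u) + e (dec v) + e (dec u) * e (dec v) := by
  rw [Tab.circ, dec_addc, dec_addc, map_add, map_add, h.mul]

theorem Rep.ok (C : Ctx N x e0) {e : A →+ R} {t : Tab} (he : Bas e N) (hx : e (dec 4) = x) (h : Rep e t)
    (b : Bool) (T) : ok b T t = true := by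
  have i : ∀ {m n}, m < 64 → n < 64 → e (dec m) = e (dec n) → Nat.beq m n = true := by
    intro m n hm hn hh
    rw [beq_iff']; exact dec_inj hm hn (he.inj hh)
  have cl : ∀ u v, t.circ u v < 64 := fun u v => addc_lt _ _
  have s2 : ∀ n, 2 * e (dec n) = 0 → 2 • dec n = 0 := by
    intro n hn
    apply he.inj
    rw [map_nsmul, nsmul_eq_mul, map_zero]; exact_mod_cast hn
  have t2 : ∀ n, 2 • dec n = 0 → 2 * e (dec n) = 0 := by
    intro n hn
    have := congrArg e hn
    rw [map_nsmul, nsmul_eq_mul, map_zero] at this; exact_mod_cast this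
  have a2 := t2 1 (by decide)
  have b2 := t2 2 (by decide)
  rw [BB.ok, Bool.and_eq_true, Bool.and_eq_true]
  refine ⟨(Tab.wf_iff t).2 ?_, ?_, ?_⟩
  · constructor <;> apply s2
    · rw [h.aa, ← mul_assoc, a2, zero_mul]
    · rw [h.ab, ← mul_assoc, a2, zero_mul]
    · rw [h.ac, ← mul_assoc, a2, zero_mul]
    · rw [h.ad, ← mul_assoc, a2, zero_mul]
    · rw [h.bb, ← mul_assoc, b2, zero_mul]
    · rw [h.bc, ← mul_assoc, b2, zero_mul]
    · rw [h.bd, ← mul_assoc, b2, zero_mul]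
  · rw [Bool.or_eq_true]; right
    have x4 := C.four C.xN
    have es : e (dec (t.circ 4 4)) = 2 * x + x ^ 2 := by rw [h.circ, hx]; ring
    have ey : e (dec (t.circ (t.circ 4 4) (t.circ 4 4))) = 2 * x ^ 2 + x ^ 4 := by
      rw [h.circ, es]; linear_combination (1 + x + x ^ 2) * x4
    have e5 : e (dec (t.circ 5 5)) = 2 * e (dec 5) + e (dec 5) ^ 2 := by rw [h.circ]; ring
    simp only [sqt, Bool.and_eq_true, Bool.or_eq_true, Bool.not_eq_true']
    refine ⟨?_, ?_⟩
    · rw [← Bool.not_eq_true, beq_iff']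
      intro hh
      rw [hh, dec_zero, map_zero] at ey
      exact C.y0 ey.symm
    · rcases C.sq (e (dec 5)) ((he.ran _).2 ⟨_, rfl⟩) with g | g | g | g
      · left; apply i (cl _ _) (by norm_num); rw [e5, g, dec_zero, map_zero]
      · right; left; apply i (cl _ _) (cl _ _); rw [e5, g, es]
      · right; right; left; apply i (cl _ _) (cl _ _); rw [e5, g, ey]
      · right; right; right; apply i (cl _ _) (cl _ _); rw [e5, g, h.circ, es, ey]
  · rw [List.all_eq_true]
    intro q _
    apply i (Tab.mul_mod ..) (Tab.mul_mod ..)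
    simp only [h.mul, mul_assoc]
end

theorem Tab.mu_comm (t : Tab) (h : t.WF) (u v : A) : t.mu h u v = t.mu h v u := by
  obtain ⟨m, -, rfl⟩ := dec_surj u
  obtain ⟨n, -, rfl⟩ := dec_surj v
  rw [Tab.mu_dec, Tab.mu_dec]
  simp only [Tab.mul, dec_lin]
  module

/-- isomorphism certificate check: `g` maps the table `t` to the table `c`, `h` is the inverse -/
def isoc (t c : Tab) (g0 g1 g2 g3 h0 h1 h2 h3 : ℕ) : Bool :=
  dz g0 && (dz g1 && (dz h0 && (dz h1 && (
  Nat.beq (lin h0 h1 h2 h3 g0) 1 && (Nat.beq (lin h0 h1 h2 h3 g1) 2 && (Nat.beq (lin h0 h1 h2 h3 g2) 4 &&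
  (Nat.beq (lin h0 h1 h2 h3 g3) 16 && (
  Nat.beq (c.mul g0 g0) (lin g0 g1 g2 g3 t.aa) && (
  Nat.beq (c.mul g0 g1) (lin g0 g1 g2 g3 t.ab) && (
  Nat.beq (c.mul g0 g2) (lin g0 g1 g2 g3 t.ac) && (
  Nat.beq (c.mul g0 g3) (lin g0 g1 g2 g3 t.ad) && (
  Nat.beq (c.mul g1 g1) (lin g0 g1 g2 g3 t.bb) && (
  Nat.beq (c.mul g1 g2) (lin g0 g1 g2 g3 t.bc) && (
  Nat.beq (c.mul g1 g3) (lin g0 g1 g2 g3 t.bd) && (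
  Nat.beq (c.mul g2 g2) (lin g0 g1 g2 g3 t.cc) && (
  Nat.beq (c.mul g2 g3) (lin g0 g1 g2 g3 t.cd) &&
  Nat.beq (c.mul g3 g3) (lin g0 g1 g2 g3 t.dd)))))))))))))))))

theorem isoc_sound {t c : Tab} {g0 g1 g2 g3 h0 h1 h2 h3 : ℕ} (H : isoc t c g0 g1 g2 g3 h0 h1 h2 h3 = true)
    (ht : t.WF) (hc : c.WF) : ∃ f : A →+ A, Function.Bijective f ∧ ∀ u v, f (t.mu ht u v) = c.mu hc (f u) (f v) := by
  simp only [isoc, Bool.and_eq_true, dz_iff, beq_iff'] at H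
  obtain ⟨q0, q1, q2, q3, l0, l1, l2, l3, aa, ab, ac, ad, bb, bc, bd, cc, cd, dd⟩ := H
  let f : A →+ A := lift4 (dec g0) (dec g1) (dec g2) (dec g3) q0 q1 (four_A _) (four_A _)
  let k : A →+ A := lift4 (dec h0) (dec h1) (dec h2) (dec h3) q2 q3 (four_A _) (four_A _)
  have hf : ∀ n, f (dec n) = dec (lin g0 g1 g2 g3 n) := by
    intro n; rw [dec_lin]; exact lift4_dec ..
  have hk : ∀ n, k (dec n) = dec (lin h0 h1 h2 h3 n) := by
    intro n; rw [dec_lin]; exact lift4_dec ..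
  have f1 : f (dec 1) = dec g0 := lift4_g1 ..
  have f2 : f (dec 2) = dec g1 := lift4_g2 ..
  have f3 : f (dec 4) = dec g2 := lift4_g3 ..
  have f4 : f (dec 16) = dec g3 := lift4_g4 ..
  have kf : k.comp f = AddMonoidHom.id A := by
    apply hom_ext4 <;> simp only [AddMonoidHom.comp_apply, f1, f2, f3, f4, hk, l0, l1, l2, l3, AddMonoidHom.id_apply]
  refine ⟨f, ?_, ?_⟩
  · apply Finite.injective_iff_bijective.1
    exact Function.LeftInverse.injective (g := k) (fun u => DFunLike.congr_fun kf u)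
  · have key : (AddMonoidHom.compHom f).comp (t.mu ht) = AddMonoidHom.compl₂ ((c.mu hc).comp f) f := by
      have base : ∀ i j gi gj, f (dec i) = dec gi → f (dec j) = dec gj → c.mul gi gj = lin g0 g1 g2 g3 (t.mul i j) →
          f (t.mu ht (dec i) (dec j)) = c.mu hc (f (dec i)) (f (dec j)) := by
        intro i j gi gj hi hj hh
        rw [hi, hj, Tab.mu_dec, Tab.mu_dec, hf, hh]
      have tl : ∀ i j n, t.mu ht (dec i) (dec j) = dec n → f (t.mu ht (dec i) (dec j)) = dec (lin g0 g1 g2 g3 n) := by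
        intro i j n hn; rw [hn, hf]
      have t11 : t.mu ht (dec 1) (dec 1) = dec t.aa := by simp only [Tab.mu, Tab.r0, lift4_g1]
      have t12 : t.mu ht (dec 1) (dec 2) = dec t.ab := by simp only [Tab.mu, Tab.r0, lift4_g1, lift4_g2]
      have t13 : t.mu ht (dec 1) (dec 4) = dec t.ac := by simp only [Tab.mu, Tab.r0, lift4_g1, lift4_g3]
      have t14 : t.mu ht (dec 1) (dec 16) = dec t.ad := by simp only [Tab.mu, Tab.r0, lift4_g1, lift4_g4]
      have t22 : t.mu ht (dec 2) (dec 2) = dec t.bb := by simp only [Tab.mu, Tab.r1, lift4_g2]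
      have t23 : t.mu ht (dec 2) (dec 4) = dec t.bc := by simp only [Tab.mu, Tab.r1, lift4_g2, lift4_g3]
      have t24 : t.mu ht (dec 2) (dec 16) = dec t.bd := by simp only [Tab.mu, Tab.r1, lift4_g2, lift4_g4]
      have t33 : t.mu ht (dec 4) (dec 4) = dec t.cc := by simp only [Tab.mu, Tab.r2, lift4_g3]
      have t34 : t.mu ht (dec 4) (dec 16) = dec t.cd := by simp only [Tab.mu, Tab.r2, lift4_g3, lift4_g4]
      have t44 : t.mu ht (dec 16) (dec 16) = dec t.dd := by simp only [Tab.mu, Tab.r3, lift4_g4]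
      apply hom_ext4 <;> apply hom_ext4 <;>
        simp only [AddMonoidHom.comp_apply, AddMonoidHom.compHom_apply_apply, AddMonoidHom.compl₂_apply,
          t11, t12, t13, t14, t22, t23, t24, t33, t34, t44, f1, f2, f3, f4, Tab.mu_dec,
          t.mu_comm ht (dec 2) (dec 1), t.mu_comm ht (dec 4) (dec 1), t.mu_comm ht (dec 16) (dec 1),
          t.mu_comm ht (dec 4) (dec 2), t.mu_comm ht (dec 16) (dec 2), t.mu_comm ht (dec 16) (dec 4), hf]
      · rw [aa]
      · rw [ab]
      · rw [ac]
      · rw [ad]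
      · rw [← Tab.mu_dec c hc, Tab.mu_comm, Tab.mu_dec, ab]
      · rw [bb]
      · rw [bc]
      · rw [bd]
      · rw [← Tab.mu_dec c hc, Tab.mu_comm, Tab.mu_dec, ac]
      · rw [← Tab.mu_dec c hc, Tab.mu_comm, Tab.mu_dec, bc]
      · rw [cc]
      · rw [cd]
      · rw [← Tab.mu_dec c hc, Tab.mu_comm, Tab.mu_dec, ad]
      · rw [← Tab.mu_dec c hc, Tab.mu_comm, Tab.mu_dec, bd]
      · rw [← Tab.mu_dec c hc, Tab.mu_comm, Tab.mu_dec, cd]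
      · rw [dd]
    intro u v
    exact DFunLike.congr_fun (DFunLike.congr_fun key u) v
end BB

namespace BB
def reps : List Tab := [
  ⟨0, 0, 2, 0, 0, 0, 0, 16, 1, 2⟩, ⟨0, 0, 2, 32, 0, 32, 0, 16, 1, 2⟩, ⟨0, 0, 0, 0, 0, 0, 0, 16, 1, 0⟩,
  ⟨0, 0, 0, 0, 32, 0, 0, 16, 1, 0⟩, ⟨0, 0, 0, 0, 0, 1, 0, 16, 1, 0⟩, ⟨0, 0, 0, 0, 32, 1, 0, 16, 1, 0⟩,
  ⟨0, 0, 0, 0, 0, 8, 32, 16, 1, 0⟩, ⟨0, 0, 0, 0, 32, 8, 32, 16, 1, 0⟩, ⟨0, 0, 0, 0, 0, 9, 32, 16, 1, 0⟩,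
  ⟨0, 0, 0, 0, 32, 9, 32, 16, 1, 0⟩, ⟨0, 0, 8, 32, 0, 0, 0, 16, 1, 8⟩, ⟨0, 32, 8, 32, 40, 1, 8, 16, 1, 8⟩,
  ⟨0, 0, 2, 0, 0, 0, 0, 16, 0, 0⟩, ⟨32, 0, 2, 0, 0, 0, 0, 16, 0, 0⟩, ⟨0, 0, 2, 32, 0, 32, 0, 16, 0, 0⟩,
  ⟨32, 0, 2, 32, 0, 32, 0, 16, 0, 0⟩, ⟨0, 0, 2, 0, 0, 0, 0, 16, 32, 0⟩, ⟨32, 0, 2, 0, 0, 0, 0, 16, 32, 0⟩,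
  ⟨0, 0, 0, 0, 0, 0, 0, 16, 0, 0⟩, ⟨0, 32, 0, 0, 0, 0, 0, 16, 0, 0⟩, ⟨0, 0, 0, 0, 32, 0, 0, 16, 0, 0⟩,
  ⟨0, 32, 0, 0, 32, 0, 0, 16, 0, 0⟩, ⟨0, 0, 0, 0, 0, 8, 32, 16, 0, 0⟩, ⟨0, 32, 0, 0, 0, 8, 32, 16, 0, 0⟩,
  ⟨0, 0, 0, 0, 32, 8, 32, 16, 0, 0⟩, ⟨0, 32, 0, 0, 32, 8, 32, 16, 0, 0⟩, ⟨32, 0, 0, 0, 0, 8, 32, 16, 0, 0⟩,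
  ⟨32, 32, 0, 0, 0, 8, 32, 16, 0, 0⟩, ⟨0, 0, 0, 0, 0, 0, 0, 16, 32, 0⟩, ⟨0, 32, 0, 0, 0, 0, 0, 16, 32, 0⟩,
  ⟨0, 0, 0, 0, 32, 0, 0, 16, 32, 0⟩, ⟨0, 32, 0, 0, 32, 0, 0, 16, 32, 0⟩, ⟨8, 0, 2, 0, 0, 8, 0, 1, 0, 32⟩,
  ⟨8, 0, 2, 0, 0, 8, 0, 1, 0, 40⟩, ⟨8, 0, 2, 0, 0, 8, 0, 1, 32, 32⟩, ⟨8, 0, 2, 0, 0, 8, 0, 1, 32, 40⟩,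
  ⟨32, 0, 2, 0, 0, 32, 0, 1, 0, 32⟩, ⟨32, 0, 2, 0, 0, 32, 0, 1, 0, 0⟩, ⟨32, 0, 2, 0, 0, 32, 0, 1, 8, 32⟩,
  ⟨32, 0, 2, 0, 0, 32, 0, 1, 8, 0⟩]
def rep (k : ℕ) : Tab := reps.getD k ⟨0, 0, 0, 0, 0, 0, 0, 0, 0, 0⟩

theorem reps_wf : ∀ k < 40, (rep k).wf = true := by decide +kernel

def chk (t : Tab) (n : ℕ) : Bool :=
  Nat.ble (n % 64) 39 && isoc t (rep (n % 64)) (n / 64 % 64) (n / 4096 % 64) (n / 262144 % 64) (n / 16777216 % 64)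
    (n / 1073741824 % 64) (n / 68719476736 % 64) (n / 4398046511104 % 64) (n / 281474976710656 % 64)

def nxt (t : Tab) (k : List ℕ → Bool) : List ℕ → Bool
  | [] => false
  | n :: cs => chk t n && k cs

def go (b : Bool) (T : List (ℕ × ℕ × ℕ)) (l : List Tab) : List ℕ → Bool :=
  l.foldr (fun t k cs => cond (ok b T t) (nxt t k cs) (k cs)) (fun _ => true)

theorem chk_sound {t : Tab} {n : ℕ} (h : chk t n = true) (ht : t.WF) : ∃ k, ∃ hk : k < 40,
    ∃ f : A →+ A, Function.Bijective f ∧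
      ∀ u v, f (t.mu ht u v) = (rep k).mu ((Tab.wf_iff _).1 (reps_wf k hk)) (f u) (f v) := by
  rw [chk, Bool.and_eq_true] at h
  have hk : n % 64 < 40 := Nat.lt_succ_of_le (Nat.le_of_ble_eq_true h.1)
  exact ⟨n % 64, hk, isoc_sound h.2 ht _⟩

theorem go_sound (b : Bool) (T : List (ℕ × ℕ × ℕ)) (l : List Tab) (cs : List ℕ) (h : go b T l cs = true) :
    ∀ t ∈ l, ok b T t = true → ∃ n, chk t n = true := by
  induction l generalizing cs with
  | nil => simp
  | cons a l ih =>
    intro t ht hok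
    have h' : cond (ok b T a) (nxt a (go b T l) cs) (go b T l cs) = true := h
    cases hc : ok b T a with
    | false =>
      rw [hc] at h'
      rcases List.mem_cons.1 ht with rfl | ht
      · rw [hc] at hok; cases hok
      · exact ih cs h' t ht hok
    | true =>
      rw [hc] at h'
      cases cs with
      | nil => cases h'
      | cons n cs =>
        have h'' : (chk a n && go b T l cs) = true := h'
        rw [Bool.and_eq_true] at h''
        rcases List.mem_cons.1 ht with rfl | ht
        · exact ⟨n, h''.1⟩
        · exact ih cs h''.2 t ht hok

def certsI1B : List ℕ := [
  4521330595602496, 4521330595602497]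
theorem goI1B : go false [] candI1B certsI1B = true := by decide +kernel
def certsI1A : List ℕ := [
  4521330595602498, 4521330595602499, 4521330595602500, 4521330595602501, 4521330595602502, 4521330595602503,
  4521330595602504, 4521330595602505, 4521880351449154, 4521880351449155, 4521880351449156, 4521880351449157,
  4521880351449158, 4521880351449159, 4521880351449160, 4521880351449161, 4521330595602506, 4521330595602507,
  4521399315083338, 4521399315083339, 4521880351449162, 4521880351449163, 4521949070929994, 4521949070929995,
  15885891508644426, 15888640287746635, 15886509983939146, 15888159251413579, 15888640287746634, 15885891508644427,
  15888159251413578, 15886509983939147]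
theorem goI1A : go false [(2, 2, 4), (1, 1, 2)] candI1A certsI1A = true := by decide +kernel
def certsI2i : List ℕ := [
  4521330595602508, 4521330595602509, 4521330595602510, 4521330595602511, 4521330595602512, 4521330595602513,
  4525728642375758, 13535127457374287]
theorem goI2i : go true [(1, 4, 16)] candI2i certsI2i = true := by decide +kernel
def certsI2ii : List ℕ := [
  4521330595602514, 4521330595602515, 4521330595602516, 4521330595602517, 4521262949863572, 4521262949863573,
  4521264023613589, 4521264023613588, 4521330595602518, 4521330595602519, 4521330595602520, 4521330595602521,
  4521330595602522, 4521330595602523, 4521399315083355, 4521399315083354, 4521880351449170, 4521880351449171,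
  4521880351449172, 4521880351449173, 4521271539830932, 4521271539830933, 4521272613580949, 4521272613580948,
  4521880351449174, 4521880351449175, 4521880351449176, 4521880351449177, 4521880351449178, 4521880351449179,
  4521949070930011, 4521949070930010, 4521262949863574, 4521262949863575, 4521262949863578, 4521262949863579,
  4521262949863576, 4521262949863577, 4521400388817115, 4521400388817114, 4521264023613590, 4521264023613591,
  4521264023613594, 4521264023613595, 4521332743086298, 4521332743086299, 4521264023613593, 4521264023613592,
  4521271539830934, 4521271539830935, 4521271539830938, 4521271539830939, 4521271539830936, 4521271539830937,
  4521958734598363, 4521958734598362, 4521272613580950, 4521272613580951, 4521272613580954, 4521272613580955,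
  4521891088867546, 4521891088867547, 4521272613580953, 4521272613580952, 4521339185537618, 4521339185537619,
  4521339185537620, 4521339185537621, 4521812705677972, 4521812705677973, 4521822369362581, 4521822369362580,
  4521339185537622, 4521339185537623, 4521339185537624, 4521339185537625, 4521339185537626, 4521339185537627,
  4521957660832347, 4521957660832346, 4521888941384274, 4521888941384275, 4521888941384276, 4521888941384277,
  4521821295645332, 4521821295645333, 4521813779460757, 4521813779460756, 4521888941384278, 4521888941384279,
  4521888941384280, 4521888941384281, 4521888941384282, 4521888941384283, 4521407905051227, 4521407905051226,
  4521812705677974, 4521812705677975, 4521812705677978, 4521812705677979, 4521812705677976, 4521812705677977,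
  4521950144631515, 4521950144631514, 4521822369362582, 4521822369362583, 4521822369362586, 4521822369362587,
  4521341333021402, 4521341333021403, 4521822369362585, 4521822369362584, 4521821295645334, 4521821295645335,
  4521821295645338, 4521821295645339, 4521821295645336, 4521821295645337, 4521408978784987, 4521408978784986,
  4521813779460758, 4521813779460759, 4521813779460762, 4521813779460763, 4521882498933466, 4521882498933467,
  4521813779460761, 4521813779460760, 4521330595602524, 4521330595602525, 4521330595602526, 4521330595602527,
  4521262949863582, 4521262949863583, 4521264023613599, 4521264023613598, 4530126689149014, 4530135279084119,
  13573060608696408, 13577535964590681, 4530126689149018, 4530135279084123, 4534602045108827, 4534593455140954,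
  4521880351449180, 4521880351449181, 4521880351449182, 4521880351449183, 4521271539830942, 4521271539830943,
  4521272613580959, 4521272613580958, 4565860817084502, 4570336172978775, 13537326480760920, 13537335070696025,
  4565860817084506, 4565869407019611, 4570336172978779, 4570327583076442, 4525660996898966, 4525669586866327,
  4525660996898970, 4525669586866331, 13568594916414104, 13577537038356697, 4534603118842587, 4534594528874714,
  4525662070648982, 4525670660616343, 4525662070648986, 4525670660616347, 4530128836632794, 4530137426567899,
  13573071346114777, 13568595990196888, 4525669586866326, 4525660996898967, 4525669586866330, 4525660996898971,
  13568603506381464, 13541794320486617, 4570328656777947, 4570337246744794, 4525670660616342, 4525662070648983,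
  4525670660616346, 4525662070648987, 4565871554502874, 4565862964568795, 13537328628244697, 13568604580098712,
  4521339185537628, 4521339185537629, 4521339185537630, 4521339185537631, 4521812705677982, 4521812705677983,
  4521822369362591, 4521822369362590, 4530135279084118, 4530126689149015, 13573069198631512, 13541793246752857,
  4530135279084122, 4530126689149019, 4570327583076443, 4570336172978778, 4521888941384284, 4521888941384285,
  4521888941384286, 4521888941384287, 4521821295645342, 4521821295645343, 4521813779460767, 4521813779460766,
  4565869407019606, 4534593455140951, 13537335070696024, 13537326480760921, 4565869407019610, 4565860817084507,
  4534593455140955, 4534602045108826, 4561395124802198, 4570337246744791, 4561395124802202, 4561403714769563,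
  13532860788510872, 13532869378478233, 4570337246744795, 4570328656777946, 4561404788486806, 4530128836632791,
  4561404788486810, 4561396198584987, 4530137426567898, 4530128836632795, 13532861862260889, 13532870452228248,
  4561403714769558, 4534594528874711, 4561403714769562, 4561395124802203, 13532869378478232, 13532860788510873,
  4534594528874715, 4534603118842586, 4561396198584982, 4565871554502871, 4561396198584986, 4561404788486811,
  4565862964568794, 4565871554502875, 13532870452228249, 13532861862260888]
theorem goI2ii : go true [(1, 2, 4), (1, 1, 2), (1, 2, 2)] candI2ii certsI2ii = true := by decide +kernel
def certsII2 : List ℕ := [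
  4521330595602528, 4521330595602529, 7899030383239264, 7899030383239265, 4802805589090401, 4802805589090400,
  8180505376727137, 8180505376727136, 5084280582578272, 5084280582578273, 8461980370215008, 8461980370215009,
  5365755576066145, 5365755576066144, 8743455363702881, 8743455363702880, 4521330595602530, 4521330595602531,
  8461980370215010, 8461980370215011, 4802805589090403, 4802805589090402, 8743455363702883, 8743455363702882,
  5084280582578274, 5084280582578275, 7899030383239266, 7899030383239267, 5365755576066147, 5365755576066146,
  8180505376727139, 8180505376727138, 4521330595602532, 4521330595602533, 14707249067862114, 15278960788122211,
  4802805589090405, 4802805589090404, 17851818013895267, 8413644527249506, 4521330595602534, 4521330595602535,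
  15278995147860064, 14707214708124257, 4802805589090407, 4802805589090406, 17280071933897313, 8985390607247456,
  5084280582578276, 5084280582578277, 15278995147860066, 14707214708124259, 5365755576066149, 5365755576066148,
  17280071933897315, 8985390607247458, 5084280582578278, 5084280582578279, 14707249067862112, 15278960788122209,
  5365755576066151, 5365755576066150, 17851818013895265, 8413644527249504, 4732471192070242, 5304191502264931,
  7899030383239268, 7899030383239269, 7877048728037987, 13884805998454882, 8180505376727141, 8180505376727140,
  5304217272068192, 4732445422266977, 7899030383239270, 7899030383239271, 7305302648040033, 14456552078452832,
  8180505376727143, 8180505376727142, 4732471192070240, 5304191502264929, 8461980370215014, 8461980370215015,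
  7877048728037985, 13884805998454880, 8743455363702887, 8743455363702886, 5304217272068194, 4732445422266979,
  8461980370215012, 8461980370215013, 7305302648040035, 14456552078452834, 8743455363702885, 8743455363702884]
theorem goII2 : go true [(1, 16, 16)] candII2 certsII2 = true := by decide +kernel
end BB

namespace BB
abbrev M := ZMod 2 × ZMod 2 × ZMod 2 × ZMod 8

theorem M_sq : ∀ g : M, g + g = 0 ∨ g + g = (0,0,0,1) + (0,0,0,1) ∨
   g + g = ((0,0,0,1) + (0,0,0,1)) + ((0,0,0,1) + (0,0,0,1)) ∨
   g + g = ((0,0,0,1) + (0,0,0,1)) + (((0,0,0,1) + (0,0,0,1)) + ((0,0,0,1) + (0,0,0,1))) := by decide +kernel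
theorem M_8 : ∀ g : M, ((g + g) + (g + g)) + ((g + g) + (g + g)) = 0 := by decide +kernel
theorem M_4 : ((((0,0,0,1) + (0,0,0,1)) + ((0,0,0,1) + (0,0,0,1))) : M) ≠ 0 := by decide +kernel

structure RS (s : A → A → A) : Prop where
  add : ∀ u v w, s u (v + w) = s u v + s u w
  comm : ∀ u v, s u v = s v u
  assoc : ∀ u v w, s (s u v) w = s u (s v w)

theorem RS.add' {s : A → A → A} (h : RS s) (u v w : A) : s (u + v) w = s u w + s v w := by
  rw [h.comm, h.add, h.comm w u, h.comm w v]
theorem RS.zero {s : A → A → A} (h : RS s) (u : A) : s u 0 = 0 := by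
  have := h.add u 0 0
  rw [add_zero, left_eq_add] at this
  exact this
theorem RS.zero' {s : A → A → A} (h : RS s) (u : A) : s 0 u = 0 := by
  rw [h.comm, h.zero]

def W {s : A → A → A} (_ : RS s) : Type := A

section
variable {s : A → A → A} (h : RS s)

instance : AddCommGroup (W h) := inferInstanceAs (AddCommGroup A)

instance : NonUnitalCommRing (W h) :=
  { (inferInstance : AddCommGroup (W h)) with
    mul := s
    left_distrib := h.add
    right_distrib := h.add'
    zero_mul := h.zero'
    mul_zero := h.zero
    mul_assoc := h.assoc
    mul_comm := h.comm }

abbrev RR := Unitization ℤ (W h)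

def io : A →+ RR h where
  toFun u := (Unitization.inr (show W h from u) : Unitization ℤ (W h))
  map_zero' := Unitization.inr_zero ℤ
  map_add' u v := Unitization.inr_add ℤ (show W h from u) (show W h from v)

theorem io_mul (u v : A) : io h (s u v) = io h u * io h v :=
  Unitization.inr_mul ℤ (show W h from u) (show W h from v)

theorem io_inj : Function.Injective (io h) :=
  fun u v huv => Unitization.inr_injective (R := ℤ) (A := W h) huv

theorem io_four (u : A) : 4 * io h u = 0 := by
  have := congrArg (io h) (four_A u)
  rw [map_nsmul, nsmul_eq_mul, map_zero] at this
  exact_mod_cast this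

theorem mkCtx (φ : A ≃ M) (hφ : ∀ u v, φ (u + v + s u v) = φ u + φ v) :
    Ctx (io h).range (io h (φ.symm (0,0,0,1))) (io h) := by
  set x0 := φ.symm (0,0,0,1) with hx0
  have p1 : φ x0 = (0,0,0,1) := by simp [hx0]
  have p0 : φ 0 = 0 := by
    have := hφ 0 0
    have s0 : s 0 0 = 0 := by
      have := h.add 0 0 0
      rwa [add_zero, left_eq_add] at this
    rw [s0, add_zero, add_zero, left_eq_add] at this
    exact this
  let o : A → A → A := fun u v => u + v + s u v
  have ho : ∀ u v, φ (o u v) = φ u + φ v := hφ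
  have io_o : ∀ u v, io h (o u v) = io h u + io h v + io h u * io h v := by
    intro u v; simp only [o, map_add, io_mul]
  set x := io h x0 with hx
  have x4 := io_four h x0
  rw [← hx] at x4
  have es : io h (o x0 x0) = 2 * x + x ^ 2 := by rw [io_o]; ring
  have ey : io h (o (o x0 x0) (o x0 x0)) = 2 * x ^ 2 + x ^ 4 := by
    rw [io_o, es]; linear_combination (1 + x + x ^ 2) * x4
  refine ⟨?_, io_inj h, ?_, ⟨x0, rfl⟩, ?_, ?_, ?_⟩
  · rintro _ _ ⟨u, rfl⟩ ⟨v, rfl⟩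
    exact ⟨s u v, io_mul h u v⟩
  · intro u; rfl
  · intro hy
    rw [← ey] at hy
    have := io_inj h (hy.trans (map_zero _).symm)
    have := congrArg φ this
    rw [ho, ho, p1, p0] at this
    exact M_4 this
  · rintro _ ⟨u, rfl⟩
    have eu : 2 * io h u + io h u ^ 2 = io h (o u u) := by rw [io_o]; ring
    rw [eu]
    have := M_sq (φ u)
    rw [← ho, ← p1, ← ho, ← ho, ← ho, ← p0, φ.injective.eq_iff, φ.injective.eq_iff, φ.injective.eq_iff,
      φ.injective.eq_iff] at this
    rcases this with g | g | g | g <;> rw [g]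
    · left; exact map_zero _
    · right; left; exact es
    · right; right; left; exact ey
    · right; right; right; rw [io_o, es, ey]
  · rintro _ ⟨u, rfl⟩
    have := M_8 (φ u)
    rw [← ho, ← ho, ← ho, ← p0, φ.injective.eq_iff] at this
    have := congrArg (io h) this
    rw [map_zero, io_o, io_o, io_o] at this
    have u4 := io_four h u
    set z := io h u
    have e8 : z ^ 8 + 2 * z ^ 4 = 0 := by
      linear_combination this - (2 + 7 * z + 14 * z ^ 2 + 17 * z ^ 3 + 14 * z ^ 4 + 7 * z ^ 5 + 2 * z ^ 6) * u4
    linear_combination (z ^ 8 - 2 * z ^ 4) * e8 + z ^ 7 * u4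

theorem pick {l : List Tab} {x : RR h} {e0 : A →+ RR h} (C : Ctx (io h).range x e0) (g : Goal (io h).range x l) {b T cs}
    (hg : go b T l cs = true) : ∃ k, ∃ hk : k < 40, ∃ F : A →+ A, Function.Bijective F ∧
      ∀ u v, F (s u v) = (rep k).mu ((Tab.wf_iff _).1 (reps_wf k hk)) (F u) (F v) := by
  obtain ⟨t, ht, e, he, hx, hr⟩ := g
  have hok := hr.ok C he hx b T
  obtain ⟨n, hn⟩ := go_sound b T l cs hg t ht hok
  have wf : t.WF := by
    rw [ok, Bool.and_eq_true] at hok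
    exact (Tab.wf_iff t).1 hok.1
  obtain ⟨k, hk, f, hf, hm⟩ := chk_sound hn wf
  have hex : ∀ u, ∃ a, e a = io h u := fun u => (he.ran _).1 ⟨u, rfl⟩
  choose j hj using hex
  have em : ∀ u v, e (t.mu wf u v) = e u * e v := by
    intro u v
    obtain ⟨m, -, rfl⟩ := dec_surj u
    obtain ⟨n, -, rfl⟩ := dec_surj v
    rw [Tab.mu_dec, hr.mul]
  let J : A →+ A :=
    { toFun := j
      map_zero' := he.inj (by rw [hj, map_zero, map_zero])
      map_add' := fun u v => he.inj (by rw [hj, map_add, map_add, hj, hj]) }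
  have jinj : Function.Injective J := fun u v huv => io_inj h (by
    rw [← hj, ← hj]; exact congrArg e huv)
  refine ⟨k, hk, f.comp J, ?_, ?_⟩
  · exact hf.comp (Finite.injective_iff_bijective.1 jinj)
  · intro u v
    change f (j (s u v)) = _
    have : j (s u v) = t.mu wf (j u) (j v) := he.inj (by rw [em, hj, hj, hj, io_mul])
    rw [this, hm]; rfl

include h in
theorem RS.classify (φ : A ≃ M) (hφ : ∀ u v, φ (u + v + s u v) = φ u + φ v) :
    ∃ k, ∃ hk : k < 40, ∃ F : A →+ A, Function.Bijective F ∧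
      ∀ u v, F (s u v) = (rep k).mu ((Tab.wf_iff _).1 (reps_wf k hk)) (F u) (F v) := by
  have C := mkCtx h φ hφ
  rcases BB.classify C with g | g | g | g | g
  · exact pick h C g goI1B
  · exact pick h C g goI1A
  · exact pick h C g goI2i
  · exact pick h C g goI2ii
  · exact pick h C g goII2
end
end BB

namespace BB
def V {s : A → A → A} (_ : RS s) : Type := A

section
variable {s : A → A → A} (h : RS s)

theorem RS.oassoc (h : RS s) (u v w : A) : (u + v + s u v) + w + s (u + v + s u v) w = u + (v + w + s v w) + s u (v + w + s v w) := by
  simp only [h.add, h.add', h.assoc]; abel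

theorem RS.ocomm (h : RS s) (u v : A) : u + v + s u v = v + u + s v u := by
  rw [h.comm, add_comm u v]

theorem RS.ozero (h : RS s) (u : A) : u + 0 + s u 0 = u := by rw [h.zero, add_zero, add_zero]
theorem RS.ozero' (h : RS s) (u : A) : 0 + u + s 0 u = u := by rw [h.zero', add_zero, zero_add]

instance : Zero (V h) := ⟨(0 : A)⟩
instance : Add (V h) := ⟨(fun u v => u + v + s u v : A → A → A)⟩

instance : AddCommMonoid (V h) where
  add_assoc := h.oassoc
  zero_add := h.ozero'
  add_zero := h.ozero
  add_comm := h.ocomm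
  nsmul := nsmulRec

theorem nsmul_mod' {G : Type*} [AddCommMonoid G] {a : G} {k : ℕ} (h : k • a = 0) (n : ℕ) : (n % k) • a = n • a := by
  conv_rhs => rw [← Nat.mod_add_div n k]
  rw [add_nsmul, mul_comm, mul_nsmul', h]; simp

theorem val_smul {G : Type*} [AddCommMonoid G] {a : G} {k : ℕ} [NeZero k] (h : k • a = 0) (i j : ZMod k) :
    (i + j).val • a = i.val • a + j.val • a := by
  rw [ZMod.val_add, nsmul_mod' h, add_nsmul]

theorem M_soc : ∀ g : M, g ≠ 0 → ∃ m : Fin 5, ∃ i j k l : Bool, (i || j || k || l) = true ∧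
   m.val • g = (cond i 1 0, cond j 1 0, cond k 1 0, cond l 4 0) := by decide +kernel

theorem exists_equiv {G : Type*} [AddCommMonoid G] [Finite G] (hc : Nat.card G = 64) (p1 p2 p3 q : G) (h1 : 2 • p1 = 0) (h2 : 2 • p2 = 0)
    (h3 : 2 • p3 = 0) (hq : 8 • q = 0)
    (soc : ∀ i j k l : Bool, (i || j || k || l) = true →
      ((cond i p1 0 + cond j p2 0) + (cond k p3 0 + cond l (4 • q) 0)) ≠ 0) :
    ∃ ψ : M ≃ G, ∀ g g', ψ (g + g') = ψ g + ψ g' := by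
  let ψ : M →+ G :=
    { toFun := fun g => (g.1.val • p1 + g.2.1.val • p2) + (g.2.2.1.val • p3 + g.2.2.2.val • q)
      map_zero' := by simp
      map_add' := fun g g' => by
        simp only [Prod.fst_add, Prod.snd_add, val_smul h1, val_smul h2, val_smul h3, val_smul hq]
        abel }
  have inj : Function.Injective ψ := by
    rw [injective_iff_map_eq_zero]
    intro g hg
    by_contra hne
    obtain ⟨m, i, j, k, l, hb, he⟩ := M_soc g hne
    have h0 : ψ (m.val • g) = 0 := by rw [map_nsmul, hg, smul_zero]
    rw [he] at h0
    apply soc i j k l hb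
    refine Eq.trans ?_ h0
    have e2 : ∀ (b : Bool) (p : G), (cond b (1 : ZMod 2) 0).val • p = cond b p 0 := by
      intro b p; cases b
      · simp
      · exact one_nsmul p
    have e8 : ∀ (b : Bool) (p : G), (cond b (4 : ZMod 8) 0).val • p = cond b (4 • p) 0 := by
      intro b p; cases b
      · simp
      · rfl
    change _ = ((cond i (1 : ZMod 2) 0).val • p1 + (cond j (1 : ZMod 2) 0).val • p2) +
      ((cond k (1 : ZMod 2) 0).val • p3 + (cond l (4 : ZMod 8) 0).val • q)
    rw [e2, e2, e2, e8]
  have hM : Nat.card M = 64 := by simp [M]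
  have bij : Function.Bijective ψ := (Nat.bijective_iff_injective_and_card ψ).2 ⟨inj, by rw [hM, hc]⟩
  exact ⟨Equiv.ofBijective ψ bij, fun g g' => map_add ψ g g'⟩
end

def asoc (t : Tab) : Bool :=
  [1, 2, 4, 16].all fun j => asc t (1, j, 2) && (asc t (1, j, 4) && (asc t (1, j, 16) && (asc t (2, j, 4) &&
    (asc t (2, j, 16) && asc t (4, j, 16)))))

theorem reps_asoc : ∀ k < 40, asoc (rep k) = true := by decide +kernel

theorem asoc_RS {t : Tab} (w : t.WF) (h : asoc t = true) : RS (fun u v => t.mu w u v) := by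
  refine ⟨fun u v x => map_add _ _ _, t.mu_comm w, ?_⟩
  have base : ∀ i j k, asc t (i, j, k) = true → t.mu w (t.mu w (dec i) (dec j)) (dec k) = t.mu w (dec i) (t.mu w (dec j) (dec k)) := by
    intro i j k hh
    rw [asc, beq_iff'] at hh
    simp only [Tab.mu_dec]
    rw [hh]
  have rev : ∀ i j k : A, t.mu w (t.mu w i j) k = t.mu w i (t.mu w j k) → t.mu w (t.mu w k j) i = t.mu w k (t.mu w j i) := by
    intro i j k hh
    rw [t.mu_comm w (t.mu w k j) i, t.mu_comm w k j, ← hh, t.mu_comm w _ k, t.mu_comm w i j]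
  have dia : ∀ i j : A, t.mu w (t.mu w i j) i = t.mu w i (t.mu w j i) := by
    intro i j; rw [t.mu_comm w _ i, t.mu_comm w j i]
  simp only [asoc, List.all_cons, List.all_nil, Bool.and_eq_true] at h
  have gen : ∀ j, (asc t (1, j, 2) = true ∧ (asc t (1, j, 4) = true ∧ (asc t (1, j, 16) = true ∧ (asc t (2, j, 4) = true ∧
    (asc t (2, j, 16) = true ∧ asc t (4, j, 16) = true))))) → ∀ u v : A, t.mu w (t.mu w u (dec j)) v = t.mu w u (t.mu w (dec j) v) := by
    rintro j ⟨h1, h2, h3, h4, h5, h6⟩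
    have key : (t.mu w).comp ((t.mu w).flip (dec j)) = AddMonoidHom.compl₂ (t.mu w) (t.mu w (dec j)) := by
      apply hom_ext4 <;> apply hom_ext4 <;> simp only [AddMonoidHom.comp_apply, AddMonoidHom.flip_apply, AddMonoidHom.compl₂_apply]
      · apply dia
      · exact base _ _ _ h1
      · exact base _ _ _ h2
      · exact base _ _ _ h3
      · exact rev _ _ _ (base _ _ _ h1)
      · apply dia
      · exact base _ _ _ h4
      · exact base _ _ _ h5
      · exact rev _ _ _ (base _ _ _ h2)
      · exact rev _ _ _ (base _ _ _ h4)
      · apply dia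
      · exact base _ _ _ h6
      · exact rev _ _ _ (base _ _ _ h3)
      · exact rev _ _ _ (base _ _ _ h5)
      · exact rev _ _ _ (base _ _ _ h6)
      · apply dia
    intro u v
    exact DFunLike.congr_fun (DFunLike.congr_fun key u) v
  intro u v x
  have fin : (t.mu w u).comp ((t.mu w).flip x) = ((t.mu w).flip x).comp (t.mu w u) := by
    apply hom_ext4 <;> simp only [AddMonoidHom.comp_apply, AddMonoidHom.flip_apply] <;> symm
    · exact gen 1 h.1 u x
    · exact gen 2 h.2.1 u x
    · exact gen 4 h.2.2.1 u x
    · exact gen 16 h.2.2.2.1 u x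
  exact (DFunLike.congr_fun fin v).symm

def pgen : List (ℕ × ℕ × ℕ) := [
  (1, 2, 8), (1, 2, 8), (1, 2, 8), (1, 8, 18), (1, 2, 8), (1, 8, 18), (1, 2, 8), (1, 8, 18),
  (1, 2, 8), (1, 8, 18), (1, 2, 8), (1, 8, 18), (1, 2, 8), (2, 8, 17), (1, 2, 8), (2, 8, 17),
  (1, 2, 8), (2, 8, 17), (1, 2, 8), (1, 2, 8), (1, 8, 18), (1, 8, 18), (1, 2, 8), (1, 2, 8),
  (1, 8, 18), (1, 8, 18), (2, 8, 17), (2, 8, 17), (1, 2, 8), (1, 2, 8), (1, 8, 18), (1, 8, 18),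
  (2, 16, 32), (2, 17, 32), (2, 16, 32), (2, 17, 32), (2, 8, 16), (2, 8, 17), (2, 8, 16), (2, 8, 17)]

def pg (k : ℕ) : ℕ × ℕ × ℕ := pgen.getD k (0, 0, 0)

def mcheck (t : Tab) (p1 p2 p3 : ℕ) : Bool :=
  let q4 := t.circ (t.circ 4 4) (t.circ 4 4)
  Nat.beq (t.circ p1 p1) 0 && (Nat.beq (t.circ p2 p2) 0 && (Nat.beq (t.circ p3 p3) 0 && (Nat.beq (t.circ q4 q4) 0 &&
    decide (∀ i j k l : Bool, (i || j || k || l) = true →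
      Nat.beq (t.circ (t.circ (cond i p1 0) (cond j p2 0)) (t.circ (cond k p3 0) (cond l q4 0))) 0 = false))))

theorem reps_mcheck : ∀ k < 40, mcheck (rep k) (pg k).1 (pg k).2.1 (pg k).2.2 = true := by decide +kernel

theorem mcheck_aux {G : Type*} [AddCommMonoid G] [Finite G] (hc : Nat.card G = 64) (D : ℕ → G) (t : Tab)
    (cd : ∀ u v, D u + D v = D (t.circ u v)) (z : D 0 = 0) (inj : ∀ m < 64, D m = 0 → m = 0)
    (p1 p2 p3 : ℕ) (hm : mcheck t p1 p2 p3 = true) : ∃ ψ : M ≃ G, ∀ g g', ψ (g + g') = ψ g + ψ g' := by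
  simp only [mcheck, Bool.and_eq_true, beq_iff', decide_eq_true_eq] at hm
  obtain ⟨h1, h2, h3, hq, hs⟩ := hm
  have four : ∀ q : G, 4 • q = (q + q) + (q + q) := by intro q; abel
  have eight : ∀ q : G, 8 • q = ((q + q) + (q + q)) + ((q + q) + (q + q)) := by intro q; abel
  have c : ∀ (b : Bool) (n : ℕ), cond b (D n) 0 = D (cond b n 0) := by
    intro b n; cases b
    · exact z.symm
    · rfl
  refine exists_equiv hc (D p1) (D p2) (D p3) (D 4)
    (by rw [two_nsmul, cd, h1, z]) (by rw [two_nsmul, cd, h2, z]) (by rw [two_nsmul, cd, h3, z])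
    (by rw [eight, cd, cd, cd, hq, z]) ?_
  intro i j k l hb he
  have hh := hs i j k l hb
  rw [four, cd, cd, c, c, c, c, cd, cd, cd] at he
  have lt : ∀ u v, t.circ u v < 64 := fun u v => addc_lt _ _
  rw [inj _ (lt _ _) he] at hh
  cases hh

theorem mcheck_sound {t : Tab} (w : t.WF) (h : RS (fun u v => t.mu w u v)) (p1 p2 p3 : ℕ) (hm : mcheck t p1 p2 p3 = true) :
    ∃ ψ : M ≃ A, ∀ g g', ψ (g + g') = ψ g + ψ g' + t.mu w (ψ g) (ψ g') := by
  haveI : Finite (V h) := inferInstanceAs (Finite A)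
  have hc : Nat.card (V h) = 64 := by change Nat.card A = 64; simp [A]
  have cd : ∀ u v : ℕ, dec u + dec v + t.mu w (dec u) (dec v) = dec (t.circ u v) := by
    intro u v
    rw [Tab.mu_dec, Tab.circ, dec_addc, dec_addc]
  obtain ⟨ψ, hψ⟩ := mcheck_aux (G := V h) hc dec t cd dec_zero
    (fun m hm e => dec_inj hm (by norm_num) (e.trans dec_zero.symm)) p1 p2 p3 hm
  exact ⟨ψ, hψ⟩
end BB

namespace BB
theorem brace_RS {B : Type*} (L : LeftBrace B) (ea : B ≃ A) (hea : ∀ x y, ea (L.add x y) = ea x + ea y)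
    (em : B ≃ M) (hem : ∀ x y, em (L.mul x y) = em x + em y) :
    RS (fun u v => ea (L.mul (ea.symm u) (ea.symm v)) - u - v) := by
  have comm : ∀ x y, L.mul x y = L.mul y x := by
    intro x y; apply em.injective; rw [hem, hem, add_comm]
  have z : ea L.zero = 0 := by
    have := hea L.zero L.zero
    rw [L.zero_add, left_eq_add] at this; exact this
  have neg : ∀ x, ea (L.neg x) = - ea x := by
    intro x
    have := hea (L.neg x) x
    rw [L.neg_add_cancel, z] at this
    exact eq_neg_of_add_eq_zero_left this.symm
  have sadd : ∀ u v, ea.symm (u + v) = L.add (ea.symm u) (ea.symm v) := by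
    intro u v; apply ea.injective; rw [hea]; simp
  obtain ⟨m, hm⟩ : ∃ m : A → A → A, ∀ u v, m u v = ea (L.mul (ea.symm u) (ea.symm v)) := ⟨_, fun _ _ => rfl⟩
  have mc : ∀ u v, m u v = m v u := fun u v => by rw [hm, hm, comm]
  have ma : ∀ u v w, m (m u v) w = m u (m v w) := fun u v w => by
    simp only [hm, Equiv.symm_apply_apply, L.mul_assoc]
  have md : ∀ u v w, m u (v + w) = m u v - u + m u w := fun u v w => by
    simp only [hm, sadd, L.brace, hea, neg, Equiv.apply_symm_apply, sub_eq_add_neg]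
  have e : (fun u v => ea (L.mul (ea.symm u) (ea.symm v)) - u - v) = fun u v => m u v - u - v := by
    funext u v; rw [hm]
  rw [e]
  have add : ∀ u v w, m u (v + w) - u - (v + w) = (m u v - u - v) + (m u w - u - w) := fun u v w => by
    rw [md]; abel
  have m0 : ∀ u, m u 0 = u := fun u => by
    have h := md u 0 0
    rw [add_zero] at h
    have h2 : m u 0 - u = 0 := by
      have : m u 0 = m u 0 + (m u 0 - u) := by rw [add_sub]; nth_rw 1 [h]; abel
      exact left_eq_add.1 this
    exact sub_eq_zero.1 h2
  have mneg : ∀ u v, m u (-v) = u + u - m u v := fun u v => by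
    have := md u v (-v)
    rw [add_neg_cancel, m0] at this
    have e : m u (-v) = (m u v - u + m u (-v)) - m u v + u := by abel
    rw [e, ← this]; abel
  have msub : ∀ u v w, m u (v - w) = m u v + u - m u w := fun u v w => by
    rw [sub_eq_add_neg, md, mneg]; abel
  refine ⟨add, fun u v => by rw [mc]; abel, fun u v w => ?_⟩
  rw [mc (m u v - u - v) w]
  simp only [msub]
  rw [mc w (m u v), ma, mc w u, mc w v]; abel

theorem brace_classify {B : Type*} (L : LeftBrace B) (ha : L.AddIso A) (hm : L.MulIso M) :
    ∃ k, ∃ hk : k < 40, ∃ e : B ≃ A, (∀ x y, e (L.add x y) = e x + e y) ∧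
      ∀ x y, e (L.mul x y) = e x + e y + (rep k).mu ((Tab.wf_iff _).1 (reps_wf k hk)) (e x) (e y) := by
  obtain ⟨ea, hea⟩ := ha
  obtain ⟨em, hem⟩ := hm
  obtain ⟨k, hk, F, bij, hF⟩ := (brace_RS L ea hea em hem).classify (ea.symm.trans em) (by
    intro u v
    have : u + v + (ea (L.mul (ea.symm u) (ea.symm v)) - u - v) = ea (L.mul (ea.symm u) (ea.symm v)) := by abel
    rw [this]; simp [hem])
  refine ⟨k, hk, ea.trans (Equiv.ofBijective F bij), fun x y => ?_, fun x y => ?_⟩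
  · simp [hea]
  · have h := hF (ea x) (ea y)
    simp only [Equiv.symm_apply_apply] at h
    simp only [Equiv.trans_apply, Equiv.ofBijective_apply]
    rw [← h, ← map_add, ← map_add]
    congr 1; abel

theorem cardA : Fintype.card A = 64 := by simp [A]
noncomputable def θ : A ≃ Fin 64 := Fintype.equivFinOfCardEq cardA

noncomputable def K {s : A → A → A} (h : RS s) (ψ : M ≃ A) (hψ : ∀ g g', ψ (g + g') = ψ g + ψ g' + s (ψ g) (ψ g')) :
    LeftBrace (Fin 64) where
  add x y := θ (θ.symm x + θ.symm y)
  zero := θ 0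
  neg x := θ (- θ.symm x)
  mul x y := θ (θ.symm x + θ.symm y + s (θ.symm x) (θ.symm y))
  one := θ 0
  inv x := θ (ψ (- ψ.symm (θ.symm x)))
  add_assoc x y z := by simp [add_assoc]
  add_comm x y := by simp [add_comm]
  zero_add x := by simp
  neg_add_cancel x := by simp
  mul_assoc x y z := by simp only [Equiv.symm_apply_apply]; rw [h.oassoc]
  one_mul x := by simp only [Equiv.symm_apply_apply]; rw [h.ozero']; simp
  mul_one x := by simp only [Equiv.symm_apply_apply]; rw [h.ozero]; simp
  inv_mul_cancel x := by
    simp only [Equiv.symm_apply_apply]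
    congr 1
    have e := hψ (- ψ.symm (θ.symm x)) (ψ.symm (θ.symm x))
    rw [neg_add_cancel, Equiv.apply_symm_apply] at e
    rw [← e]
    have z := hψ 0 0
    rw [add_zero] at z
    have e2 : ψ 0 + s (ψ 0) (ψ 0) = 0 := by
      have : ψ 0 = ψ 0 + (ψ 0 + s (ψ 0) (ψ 0)) := by rw [← add_assoc]; exact z
      exact left_eq_add.1 this
    have key := hψ 0 (ψ.symm 0)
    rw [zero_add, Equiv.apply_symm_apply, h.zero, add_zero, add_zero] at key
    exact key.symm
  brace x y z := by
    simp only [Equiv.symm_apply_apply]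
    rw [h.add]; congr 1; abel

theorem K_add {s : A → A → A} (h : RS s) (ψ : M ≃ A) (hψ) : (K h ψ hψ).AddIso A :=
  ⟨θ.symm, fun x y => by simp [K]⟩

theorem K_mul {s : A → A → A} (h : RS s) (ψ : M ≃ A) (hψ) : (K h ψ hψ).MulIso M :=
  ⟨θ.symm.trans ψ.symm, fun x y => by
    apply ψ.injective
    rw [hψ]
    simp [K]⟩

theorem rep_RS (k : ℕ) (hk : k < 40) : RS (fun u v => (rep k).mu ((Tab.wf_iff _).1 (reps_wf k hk)) u v) :=
  asoc_RS _ (reps_asoc k hk)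

theorem rep_psi (k : ℕ) (hk : k < 40) : ∃ ψ : M ≃ A, ∀ g g', ψ (g + g') = ψ g + ψ g' +
    (rep k).mu ((Tab.wf_iff _).1 (reps_wf k hk)) (ψ g) (ψ g') :=
  mcheck_sound _ (rep_RS k hk) _ _ _ (reps_mcheck k hk)

noncomputable def KK (k : Fin 40) : LeftBrace (Fin 64) :=
  K (rep_RS k.1 k.2) (rep_psi k.1 k.2).choose (rep_psi k.1 k.2).choose_spec

theorem KK_surj (L : LeftBrace (Fin 64)) (ha : L.AddIso A) (hm : L.MulIso M) : ∃ k, (KK k).Iso L := by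
  obtain ⟨k, hk, e, h1, h2⟩ := brace_classify L ha hm
  refine ⟨⟨k, hk⟩, (e.trans θ).symm, fun x y => ?_, fun x y => ?_⟩
  · apply (e.trans θ).injective
    simp [KK, K, h1]
  · apply (e.trans θ).injective
    simp [KK, K, h2]

theorem KK_iso (j k : Fin 40) (h : (KK j).Iso (KK k)) : ∃ F : A ≃+ A, ∀ u v,
    F ((rep j.1).mu ((Tab.wf_iff _).1 (reps_wf j.1 j.2)) u v) =
      (rep k.1).mu ((Tab.wf_iff _).1 (reps_wf k.1 k.2)) (F u) (F v) := by
  obtain ⟨e, h1, h2⟩ := h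
  let F : A ≃+ A := { (θ.trans e).trans θ.symm with
    map_add' := fun u v => by
      have := h1 (θ u) (θ v)
      simp only [KK, K, Equiv.symm_apply_apply] at this
      simp [this] }
  have hF : ∀ u, F u = θ.symm (e (θ u)) := fun u => rfl
  refine ⟨F, fun u v => ?_⟩
  have := h2 (θ u) (θ v)
  simp only [KK, K, Equiv.symm_apply_apply] at this
  have this := congrArg θ.symm this
  rw [Equiv.symm_apply_apply, ← hF, map_add, map_add, ← hF, ← hF] at this
  exact add_left_cancel this
end BB

namespace BB
/-- code of the polynomial with coefficients coded by `c`, evaluated at `u` -/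
def Tab.pol (t : Tab) (c u : ℕ) : ℕ :=
  bif Nat.beq (c % 4) 0 then (bif Nat.beq (c / 16 % 4) 0 then lin 0 0 u 0 c else lin 0 0 u (t.mul u u) c) else
  lin (t.mul (t.mul u u) u) (t.mul (t.mul u u) (t.mul u u)) u (t.mul u u) c

def polA (s : A → A → A) (c : ℕ) (u : A) : A :=
  (c % 2) • s (s u u) u + (c / 2 % 2) • s (s u u) (s u u) + (c / 4 % 4) • u + (c / 16 % 4) • s u u

theorem Tab.dec_pol (t : Tab) (w : t.WF) (c u : ℕ) : dec (t.pol c u) = polA (fun u v => t.mu w u v) c (dec u) := by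
  unfold Tab.pol polA
  simp only [Tab.mu_dec]
  rcases h : Nat.beq (c % 4) 0 with _ | _
  · simp only [cond_false, dec_lin]
  · have h1 := beq_iff'.1 h
    have e1 : c % 2 = 0 := by omega
    have e2 : c / 2 % 2 = 0 := by omega
    rcases h' : Nat.beq (c / 16 % 4) 0 with _ | _
    · simp only [cond_true, cond_false, dec_lin, e1, e2, zero_smul]
    · simp only [cond_true, dec_lin, e1, e2, beq_iff'.1 h', zero_smul]

theorem Tab.pol_lt (t : Tab) (c u : ℕ) : t.pol c u < 64 := by
  unfold Tab.pol
  rcases Nat.beq (c % 4) 0 with _ | _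
  · exact lin_lt ..
  · rcases Nat.beq (c / 16 % 4) 0 with _ | _ <;> exact lin_lt ..

theorem polA_map (F : A ≃+ A) (s s' : A → A → A) (h : ∀ u v, F (s u v) = s' (F u) (F v)) (c : ℕ) (u : A) :
    F (polA s c u) = polA s' c (F u) := by
  simp only [polA, map_add, map_nsmul, h]

def SS (s : A → A → A) (c : ℕ × ℕ × ℕ) : Set (A × A) :=
  {p | polA s c.1 p.1 = 0 ∧ polA s c.2.1 p.2 = 0 ∧ s p.1 p.2 + polA s c.2.2 p.1 = 0}

theorem SS_card (F : A ≃+ A) (s s' : A → A → A) (h : ∀ u v, F (s u v) = s' (F u) (F v)) (c : ℕ × ℕ × ℕ) :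
    (SS s c).ncard = (SS s' c).ncard := by
  have : SS s' c = (F.toEquiv.prodCongr F.toEquiv) '' SS s c := by
    rw [Equiv.image_eq_preimage_symm]
    ext ⟨u, v⟩
    obtain ⟨u, rfl⟩ := F.surjective u
    obtain ⟨v, rfl⟩ := F.surjective v
    simp [SS, ← polA_map F s s' h, ← h, ← map_add]
  rw [this, Set.ncard_image_of_injective _ (Equiv.injective _)]

/-- filter the numbers below `n` and pass the result to `k` -/
def filt (p : ℕ → Bool) (k : List ℕ → ℕ) : ℕ → List ℕ → ℕ
  | 0, acc => k acc
  | n + 1, acc => bif p n then filt p k n (n :: acc) else filt p k n acc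

def count (p : ℕ → Bool) : List ℕ → ℕ
  | [] => 0
  | a :: l => bif p a then Nat.add (count p l) 1 else count p l

def sumL (f : ℕ → ℕ) : List ℕ → ℕ
  | [] => 0
  | a :: l => Nat.add (f a) (sumL f l)

def Tab.row (t : Tab) (u g : ℕ) (L : List ℕ) : ℕ :=
  count (fun v => Nat.beq (addc (lin (lin t.aa t.ab t.ac t.ad u) (lin t.ab t.bb t.bc t.bd u) (lin t.ac t.bc t.cc t.cd u)
    (lin t.ad t.bd t.cd t.dd u) v) g) 0) L

def Tab.cnt (t : Tab) (c : ℕ × ℕ × ℕ) : ℕ :=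
  filt (fun v => Nat.beq (t.pol c.2.1 v) 0) (fun L =>
    filt (fun u => Nat.beq (t.pol c.1 u) 0) (fun U => sumL (fun u => t.row u (t.pol c.2.2 u) L) U) 64 []) 64 []

theorem filt_eq (p k) : ∀ n acc, filt p k n acc = k ((List.range n).filter p ++ acc) := by
  intro n
  induction n with
  | zero => intro acc; rfl
  | succ n ih =>
    intro acc
    rw [filt, List.range_succ, List.filter_append]
    rcases h : p n with _ | _
    · simp [ih, h]
    · simp [ih, h]

theorem count_eq (p) : ∀ l, count p l = (l.filter p).length := by
  intro l
  induction l with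
  | nil => rfl
  | cons a l ih => rw [count, ih]; rcases h : p a with _ | _ <;> simp [h]

theorem sumL_eq (f) : ∀ l, sumL f l = (l.map f).sum := by
  intro l
  induction l with
  | nil => rfl
  | cons a l ih => rw [sumL, ih]; simp

theorem beq_zero {n : ℕ} (hn : n < 64) : Nat.beq n 0 = true ↔ dec n = 0 := by
  rw [beq_iff']
  constructor
  · rintro rfl; exact dec_zero
  · intro h; exact dec_inj hn (by norm_num) (h.trans dec_zero.symm)

theorem Tab.cnt_eq (t : Tab) (w : t.WF) (c : ℕ × ℕ × ℕ) : t.cnt c = (SS (fun u v => t.mu w u v) c).ncard := by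
  set s : A → A → A := fun u v => t.mu w u v with hs
  let S : Finset (ℕ × ℕ) := ((List.range 64).filter (fun u => Nat.beq (t.pol c.1 u) 0)).toFinset.sigma
    (fun u => (((List.range 64).filter (fun v => Nat.beq (t.pol c.2.1 v) 0)).filter (fun v => Nat.beq (addc (t.mul v u) (t.pol c.2.2 u)) 0)).toFinset)
    |>.map (Equiv.sigmaEquivProd ℕ ℕ).toEmbedding
  have nd : ((List.range 64).filter (fun u => Nat.beq (t.pol c.1 u) 0)).Nodup := List.nodup_range.filter _
  have h1 : t.cnt c = S.card := by
    rw [Finset.card_map, Finset.card_sigma, Tab.cnt, filt_eq, filt_eq, sumL_eq, List.append_nil, List.append_nil]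
    rw [List.sum_toFinset _ nd]
    congr 1
    apply List.map_congr_left
    intro u _
    rw [List.toFinset_card_of_nodup ((List.nodup_range.filter _).filter _), Tab.row, count_eq]
    rfl
  have h2 : SS s c = ((fun p : ℕ × ℕ => (dec p.1, dec p.2)) '' (S : Set (ℕ × ℕ))) := by
    ext ⟨u, v⟩
    obtain ⟨m, hm, rfl⟩ := dec_surj u
    obtain ⟨n, hn, rfl⟩ := dec_surj v
    have mem : ∀ i j, ((i, j) : ℕ × ℕ) ∈ S ↔ (i < 64 ∧ polA s c.1 (dec i) = 0) ∧ (j < 64 ∧ polA s c.2.1 (dec j) = 0) ∧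
        s (dec i) (dec j) + polA s c.2.2 (dec i) = 0 := by
      intro i j
      have e3 : dec (addc (t.mul j i) (t.pol c.2.2 i)) = s (dec i) (dec j) + polA s c.2.2 (dec i) := by
        rw [dec_addc, ← t.mu_dec w, t.mu_comm w, t.dec_pol w]
      have e1 := beq_zero (t.pol_lt c.1 i)
      have e2 := beq_zero (t.pol_lt c.2.1 j)
      have e4 := beq_zero (addc_lt (t.mul j i) (t.pol c.2.2 i))
      rw [t.dec_pol w] at e1 e2
      rw [e3] at e4
      rw [← hs] at e1 e2
      rw [← e1, ← e2, ← e4]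
      simp [S, and_assoc, Equiv.sigmaEquivProd]; tauto
    constructor
    · rintro ⟨a, b, d⟩
      exact ⟨(m, n), (mem m n).2 ⟨⟨hm, a⟩, ⟨hn, b⟩, d⟩, rfl⟩
    · rintro ⟨⟨i, j⟩, hij, he⟩
      obtain ⟨⟨-, a⟩, ⟨-, b⟩, d⟩ := (mem i j).1 hij
      rw [← he]
      exact ⟨a, b, d⟩
  rw [h1, h2, Set.InjOn.ncard_image, Set.ncard_coe_finset]
  rintro ⟨i, j⟩ hij ⟨i', j'⟩ hij' he
  have b : ∀ i j, ((i, j) : ℕ × ℕ) ∈ S → i < 64 ∧ j < 64 := by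
    intro i j h
    simp [S, Equiv.sigmaEquivProd] at h
    omega
  have := b i j hij
  have := b i' j' hij'
  simp only [Prod.mk.injEq] at he
  rw [dec_inj (by omega) (by omega) he.1, dec_inj (by omega) (by omega) he.2]

def invs : List ((ℕ × ℕ × ℕ) × List ℕ) := [
  ((8, 16, 16), [256, 256, 512, 128, 512, 128, 384, 192, 384, 192, 256, 64, 512, 128, 384, 192, 512, 128, 512, 320, 128, 192, 384, 320, 192, 192, 128, 160, 512, 320, 128, 192, 64, 64, 64, 64, 192, 128, 192, 128]),
  ((4, 1, 0), [32, 32, 32, 32, 32, 32, 32, 32, 32, 32, 32, 32, 64, 64, 48, 48, 32, 32, 64, 64, 64, 64, 48, 48, 48, 48, 48, 0, 32, 32, 32, 32, 32, 32, 32, 32, 32, 32, 32, 32]),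
  ((8, 0, 0), [640, 512, 768, 640, 640, 512, 512, 512, 512, 512, 512, 320, 640, 512, 512, 512, 640, 512, 768, 0, 640, 0, 512, 0, 512, 448, 0, 0, 768, 0, 640, 576, 512, 512, 512, 512, 512, 512, 512, 512]),
  ((4, 33, 0), [0, 32, 32, 32, 32, 32, 32, 32, 32, 32, 32, 0, 0, 0, 48, 48, 64, 64, 0, 0, 0, 0, 48, 0, 48, 0, 0, 0, 64, 0, 64, 0, 32, 32, 32, 32, 32, 32, 32, 32]),
  ((0, 24, 8), [0, 384, 0, 0, 0, 256, 512, 384, 384, 512, 512, 0, 0, 0, 384, 384, 0, 0, 0, 0, 0, 0, 512, 0, 512, 0, 0, 0, 0, 0, 0, 0, 576, 320, 448, 320, 384, 256, 512, 256]),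
  ((4, 32, 0), [0, 0, 0, 0, 0, 32, 0, 32, 0, 32, 0, 0, 0, 0, 0, 0, 0, 0, 0, 0, 0, 0, 0, 0, 0, 0, 0, 0, 0, 0, 0, 0, 0, 64, 0, 64, 64, 64, 64, 64]),
  ((16, 0, 0), [0, 0, 0, 0, 0, 0, 0, 0, 0, 0, 0, 0, 0, 0, 0, 0, 0, 0, 0, 0, 0, 0, 0, 0, 0, 0, 0, 0, 0, 0, 0, 0, 0, 384, 0, 384, 0, 768, 0, 640]),
  ((10, 24, 1), [0, 0, 0, 0, 0, 0, 0, 0, 0, 0, 0, 0, 0, 0, 0, 0, 0, 0, 0, 0, 0, 0, 0, 0, 0, 0, 0, 0, 0, 0, 0, 0, 0, 256, 0, 192, 0, 0, 0, 0])]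

def ichk (k : ℕ) (r : (ℕ × ℕ × ℕ) × List ℕ) : Bool :=
  Nat.beq (r.2.getD k 0) 0 || Nat.beq ((rep k).cnt r.1) (r.2.getD k 0)

def sep (j k : ℕ) (r : (ℕ × ℕ × ℕ) × List ℕ) : Bool :=
  let a := r.2.getD j 0
  let b := r.2.getD k 0
  !(Nat.beq a 0) && (!(Nat.beq b 0) && !(Nat.beq a b))

theorem chk_all : ∀ k < 40, invs.all (ichk k) = true := by decide +kernel
theorem sep_all : ∀ j < 40, ∀ k < 40, (Nat.beq j k || invs.any (sep j k)) = true := by decide +kernel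

theorem KK_inj (j k : Fin 40) (h : (KK j).Iso (KK k)) : j = k := by
  obtain ⟨F, hF⟩ := KK_iso j k h
  by_contra hne
  have h1 := sep_all j.1 j.2 k.1 k.2
  rw [Bool.or_eq_true, beq_iff'] at h1
  rcases h1 with h1 | h1
  · exact hne (Fin.ext h1)
  rw [List.any_eq_true] at h1
  obtain ⟨r, hr, hs⟩ := h1
  have cj := List.all_eq_true.1 (chk_all j.1 j.2) r hr
  have ck := List.all_eq_true.1 (chk_all k.1 k.2) r hr
  simp only [sep, ichk, Bool.and_eq_true, Bool.or_eq_true, Bool.not_eq_true', ← Bool.not_eq_true, beq_iff'] at hs cj ck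
  have ej := cj.resolve_left hs.1
  have ek := ck.resolve_left hs.2.1
  apply hs.2.2
  rw [← ej, ← ek, Tab.cnt_eq _ ((Tab.wf_iff _).1 (reps_wf j.1 j.2)), Tab.cnt_eq _ ((Tab.wf_iff _).1 (reps_wf k.1 k.2))]
  exact SS_card F _ _ hF _
end BB

/-- The number of isomorphism classes of left braces with additive group
isomorphic to `C₂ × C₂ × C₄ × C₄` and multiplicative group isomorphic to
`C₂ × C₂ × C₂ × C₈` is `40`. -/
theorem number_of_braces_by_mul_group :
    Nat.card (Quot (fun (L₁ L₂ : {L : LeftBrace (Fin 64) //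
        L.AddIso (ZMod 2 × ZMod 2 × ZMod 4 × ZMod 4) ∧
        L.MulIso (ZMod 2 × ZMod 2 × ZMod 2 × ZMod 8)}) => L₁.1.Iso L₂.1)) = 40 := by
  refine (Nat.card_eq_of_bijective (α := Fin 40)
    (fun k => Quot.mk _ ⟨BB.KK k, BB.K_add _ _ _, BB.K_mul _ _ _⟩) ⟨?_, ?_⟩).symm.trans (Nat.card_fin 40)
  · intro j k h
    have eqv : Equivalence (fun (L₁ L₂ : {L : LeftBrace (Fin 64) //
        L.AddIso (ZMod 2 × ZMod 2 × ZMod 4 × ZMod 4) ∧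
        L.MulIso (ZMod 2 × ZMod 2 × ZMod 2 × ZMod 8)}) => L₁.1.Iso L₂.1) := by
      refine ⟨fun L => ⟨Equiv.refl _, fun _ _ => rfl, fun _ _ => rfl⟩, ?_, ?_⟩
      · rintro L₁ L₂ ⟨e, h1, h2⟩
        refine ⟨e.symm, fun x y => ?_, fun x y => ?_⟩ <;> apply e.injective <;> simp [h1, h2]
      · rintro L₁ L₂ L₃ ⟨e, h1, h2⟩ ⟨e', h1', h2'⟩
        exact ⟨e.trans e', fun x y => by simp [h1, h1'], fun x y => by simp [h2, h2']⟩
    exact BB.KK_inj j k ((eqv.quot_mk_eq_iff _ _).1 h)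
  · intro q
    obtain ⟨⟨L, ha, hm⟩, rfl⟩ := Quot.exists_rep q
    obtain ⟨k, hk⟩ := BB.KK_surj L ha hm
    exact ⟨k, Quot.sound hk⟩
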